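/- arXiv:2011.10636 — 2 statements merged into one kernel-verified Lean document; each statement's English description precedes it below -/
import Mathlib

section
/- Under the setup and the semi-discrete assumptions, suppose the discrete inf-sup condition holds with β* > 0: sup_{v ∈ V_h} b(v,q)/‖v‖_V ≥ β*‖q‖_Q for all q ∈ H_h^⊥ ∩ Q_h and sup_{q ∈ Q_h} b(v,q)/‖q‖_Q ≥ β*‖v‖_V for all v ∈ K_h^⊥ ∩ V_h (orthogonal complements taken inside V_h and Q_h). Then for every f ∈ L¹(J;V') and g ∈ L¹(J;Q') the semi-discrete Problem (P_h) has a unique solution (u_h,p_h) ∈ L¹(J;V_h) × L¹(J;Q_h), and if (u,p) solves Problem (P), there exists a constant C > 0, depending only on α₀*, β*, γ₀*, ‖a‖, ‖b‖, ‖c‖, C_{k₁},…,C_{k₄} and T, such that ‖u_h − u‖_{L¹(J;V)} + ‖p_h − p‖_{L¹(J;Q)} ≤ C ( inf_{v ∈ L¹(J;V_h)} ‖u − v‖_{L¹(J;V)} + inf_{q ∈ L¹(J;Q_h)} ‖p − q‖_{L¹(J;Q)} ). -/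
open MeasureTheory




/-- `(u, p)` solves the Volterra mixed Problem (P), tested against `Vt × Qt`
(for `Vt = ⊤`, `Qt = ⊤` this is Problem (P); for subspaces it is the
semi-discrete Problem (P_h)). -/
def SolvesPOn (V Q : Type) [NormedAddCommGroup V] [NormedSpace ℝ V]
    [NormedAddCommGroup Q] [NormedSpace ℝ Q] (T : ℝ)
    (a : V →L[ℝ] V →L[ℝ] ℝ) (b : V →L[ℝ] Q →L[ℝ] ℝ) (c : Q →L[ℝ] Q →L[ℝ] ℝ)
    (k₁ k₂ k₃ k₄ : ℝ → ℝ → ℝ) (f : ℝ → V →L[ℝ] ℝ) (g : ℝ → Q →L[ℝ] ℝ)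
    (Vt : Submodule ℝ V) (Qt : Submodule ℝ Q)
    (u : ℝ → V) (p : ℝ → Q) : Prop :=
  ∀ᵐ t ∂volume, t ∈ Set.Icc (0:ℝ) T →
    (∀ v ∈ Vt, a (u t) v + b v (p t)
        = f t v + ∫ s in (0:ℝ)..t, (k₁ t s * a (u s) v + k₂ t s * b v (p s))) ∧
    (∀ q ∈ Qt, b (u t) q - c (p t) q
        = g t q + ∫ s in (0:ℝ)..t, (k₃ t s * b (u s) q - k₄ t s * c (p s) q))

/-- The discrete kernel `K_h = {v ∈ V_h : b(v,q) = 0 ∀ q ∈ Q_h}`. -/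
noncomputable def discKh (V Q : Type) [NormedAddCommGroup V] [NormedSpace ℝ V]
    [NormedAddCommGroup Q] [NormedSpace ℝ Q] (b : V →L[ℝ] Q →L[ℝ] ℝ)
    (Vh : Submodule ℝ V) (Qh : Submodule ℝ Q) : Submodule ℝ V :=
  Vh ⊓ ⨅ q ∈ Qh, LinearMap.ker (b.flip q).toLinearMap

/-- The discrete kernel `H_h = {q ∈ Q_h : b(v,q) = 0 ∀ v ∈ V_h}`. -/
noncomputable def discHh (V Q : Type) [NormedAddCommGroup V] [NormedSpace ℝ V]
    [NormedAddCommGroup Q] [NormedSpace ℝ Q] (b : V →L[ℝ] Q →L[ℝ] ℝ)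
    (Vh : Submodule ℝ V) (Qh : Submodule ℝ Q) : Submodule ℝ Q :=
  Qh ⊓ ⨅ v ∈ Vh, LinearMap.ker (b v).toLinearMap


lemma aux_real (α β γ Na Nc : ℝ) (hα : 0 < α) (hβ : 0 < β) (hγ : 0 < γ) (hNa : 0 ≤ Na)
    (hNc : 0 ≤ Nc) : ∃ M : ℝ, 0 < M ∧ ∀ x0 x1 y0 y1 D E X : ℝ, 0 ≤ D → 0 ≤ X → 0 ≤ E →
      β ^ 2 * y1 ^ 2 ≤ 2 * D ^ 2 + 2 * (Na * E) → β ^ 2 * x1 ^ 2 ≤ 2 * D ^ 2 + 2 * (Nc * E) →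
      α * x0 ^ 2 ≤ 2 * E + 2 * (Na * x1 ^ 2) → γ * y0 ^ 2 ≤ 2 * E + 2 * (Nc * y1 ^ 2) →
      E ≤ D * X → X ≤ x0 + x1 + y0 + y1 → X ≤ M * D := by
  obtain ⟨i, hi⟩ : ∃ i, i = 2 / β ^ 2 := ⟨_, rfl⟩
  obtain ⟨j, hj⟩ : ∃ j, j = 2 / α := ⟨_, rfl⟩
  obtain ⟨k, hk⟩ : ∃ k, k = 2 / γ := ⟨_, rfl⟩
  have hi0 : 0 < i := by rw [hi]; positivity
  have hj0 : 0 < j := by rw [hj]; positivity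
  have hk0 : 0 < k := by rw [hk]; positivity
  refine ⟨1 + 4 * (i + i + j * Na * i + k * Nc * i) +
    4 * (i * Na + i * Nc + j + j * Na * i * Nc + k + k * Nc * i * Na), by positivity, ?_⟩
  intro x0 x1 y0 y1 D E X hD hX hE h1 h2 h3 h4 h5 h6
  have g1 : y1 ^ 2 ≤ i * D ^ 2 + i * Na * E := by
    have : y1 ^ 2 ≤ (2 * D ^ 2 + 2 * (Na * E)) / β ^ 2 := by
      rw [le_div_iff₀ (by positivity)]; linarith
    calc _ ≤ _ := this
      _ = _ := by rw [hi]; ring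
  have g2 : x1 ^ 2 ≤ i * D ^ 2 + i * Nc * E := by
    have : x1 ^ 2 ≤ (2 * D ^ 2 + 2 * (Nc * E)) / β ^ 2 := by
      rw [le_div_iff₀ (by positivity)]; linarith
    calc _ ≤ _ := this
      _ = _ := by rw [hi]; ring
  have g3 : x0 ^ 2 ≤ j * E + j * Na * x1 ^ 2 := by
    have : x0 ^ 2 ≤ (2 * E + 2 * (Na * x1 ^ 2)) / α := by
      rw [le_div_iff₀ (by positivity)]; linarith
    calc _ ≤ _ := this
      _ = _ := by rw [hj]; ring
  have g4 : y0 ^ 2 ≤ k * E + k * Nc * y1 ^ 2 := by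
    have : y0 ^ 2 ≤ (2 * E + 2 * (Nc * y1 ^ 2)) / γ := by
      rw [le_div_iff₀ (by positivity)]; linarith
    calc _ ≤ _ := this
      _ = _ := by rw [hk]; ring
  have g3' : x0 ^ 2 ≤ j * E + j * Na * (i * D ^ 2 + i * Nc * E) := g3.trans (by gcongr)
  have g4' : y0 ^ 2 ≤ k * E + k * Nc * (i * D ^ 2 + i * Na * E) := g4.trans (by gcongr)
  have hA0 : 0 ≤ 4 * (i + i + j * Na * i + k * Nc * i) := by positivity
  have hB0 : 0 ≤ 4 * (i * Na + i * Nc + j + j * Na * i * Nc + k + k * Nc * i * Na) := by positivity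
  set A := 4 * (i + i + j * Na * i + k * Nc * i) with hA
  set B := 4 * (i * Na + i * Nc + j + j * Na * i * Nc + k + k * Nc * i * Na) with hB
  have h7 : X ^ 2 ≤ A * D ^ 2 + B * E := by
    have : X ^ 2 ≤ (x0 + x1 + y0 + y1) ^ 2 := by gcongr
    have h8 : (x0 + x1 + y0 + y1) ^ 2 ≤ 4 * (x0 ^ 2 + x1 ^ 2 + y0 ^ 2 + y1 ^ 2) := by
      nlinarith [sq_nonneg (x0 - x1), sq_nonneg (x0 - y0), sq_nonneg (x0 - y1),
        sq_nonneg (x1 - y0), sq_nonneg (x1 - y1), sq_nonneg (y0 - y1)]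
    rw [hA, hB]
    linarith
  clear_value A B
  by_contra! hc
  have hDX : D ≤ X := by
    have : 0 ≤ (A + B) * D := by positivity
    linarith
  have hXp : 0 < X := lt_of_le_of_lt (by positivity) hc
  have e1 : B * E ≤ B * (D * X) := by gcongr
  have e2 : A * D ^ 2 ≤ A * (D * X) := by
    rw [pow_two]; gcongr
  have e3 : (1 + A + B) * D * X < X * X := by gcongr
  have e4 : 0 ≤ D * X := by positivity
  linarith

lemma aux_cs {V : Type} [NormedAddCommGroup V] [InnerProductSpace ℝ V]
    (a : V →L[ℝ] V →L[ℝ] ℝ) (hs : ∀ v w : V, a v w = a w v) (hp : ∀ v : V, 0 ≤ a v v)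
    (u v : V) : (a u v) ^ 2 ≤ a u u * a v v := by
  have h : ∀ x : ℝ, 0 ≤ (a v v) * (x * x) + (2 * a u v) * x + a u u := by
    intro x
    have := hp (u + x • v)
    simp only [map_add, map_smul, _root_.add_apply, _root_.smul_apply,
      smul_eq_mul] at this
    rw [hs v u] at this
    linarith
  have := discrim_le_zero h
  unfold discrim at this
  linarith

lemma aux_nrm {V W : Type} [NormedAddCommGroup V] [NormedSpace ℝ V] [NormedAddCommGroup W]
    [NormedSpace ℝ W] (a : V →L[ℝ] W →L[ℝ] ℝ) {N : ℝ} (hN : ‖a‖ ≤ N) (u : V) (v : W) :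
    |a u v| ≤ N * ‖u‖ * ‖v‖ := by
  have := a.le_opNorm₂ u v
  rw [Real.norm_eq_abs] at this
  exact this.trans (by gcongr)

/-- Uniform stability of the discrete mixed problem. -/
lemma aux_stab (α β γ Na Nc : ℝ) (hα : 0 < α) (hβ : 0 < β) (hγ : 0 < γ) (hNa : 0 ≤ Na)
    (hNc : 0 ≤ Nc) : ∃ M : ℝ, 0 < M ∧ ∀ (V Q : Type)
        [NormedAddCommGroup V] [InnerProductSpace ℝ V]
        [NormedAddCommGroup Q] [InnerProductSpace ℝ Q]
        (a : V →L[ℝ] V →L[ℝ] ℝ) (b : V →L[ℝ] Q →L[ℝ] ℝ) (c : Q →L[ℝ] Q →L[ℝ] ℝ),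
        (∀ v w : V, a v w = a w v) → (∀ v : V, 0 ≤ a v v) →
        (∀ q r : Q, c q r = c r q) → (∀ q : Q, 0 ≤ c q q) →
        ‖a‖ ≤ Na → ‖c‖ ≤ Nc →
        ∀ (Vh : Submodule ℝ V) (Qh : Submodule ℝ Q),
        FiniteDimensional ℝ Vh → FiniteDimensional ℝ Qh →
        (∀ v ∈ discKh V Q b Vh Qh, α * ‖v‖ ^ 2 ≤ a v v) →
        (∀ q ∈ discHh V Q b Vh Qh, γ * ‖q‖ ^ 2 ≤ c q q) →
        (∀ q : Q, q ∈ Qh → q ∈ (discHh V Q b Vh Qh)ᗮ →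
          ∃ v ∈ Vh, ‖v‖ ≤ 1 ∧ β * ‖q‖ ≤ b v q) →
        (∀ v : V, v ∈ Vh → v ∈ (discKh V Q b Vh Qh)ᗮ →
          ∃ q ∈ Qh, ‖q‖ ≤ 1 ∧ β * ‖v‖ ≤ b v q) →
        ∀ u ∈ Vh, ∀ p ∈ Qh, ∀ D : ℝ, 0 ≤ D →
          (∀ v ∈ Vh, |a u v + b v p| ≤ D * ‖v‖) → (∀ q ∈ Qh, |b u q - c p q| ≤ D * ‖q‖) →
          ‖u‖ + ‖p‖ ≤ M * D := by
  obtain ⟨M, hM, H⟩ := aux_real α β γ Na Nc hα hβ hγ hNa hNc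
  refine ⟨M, hM, ?_⟩
  intro V Q _ _ _ _ a b c has hap hcs hcp ha hc Vh Qh _ _ hKα hHγ hib hiv u hu p hp D hD hF hG
  set K := discKh V Q b Vh Qh with hK
  set Hh := discHh V Q b Vh Qh with hHh
  have hKV : K ≤ Vh := inf_le_left
  have hHQ : Hh ≤ Qh := inf_le_left
  have : FiniteDimensional ℝ K := Submodule.finiteDimensional_of_le hKV
  have : FiniteDimensional ℝ Hh := Submodule.finiteDimensional_of_le hHQ
  have hKb : ∀ v ∈ K, ∀ q ∈ Qh, b v q = 0 := by
    intro v hv q hq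
    have := hv.2
    simp only [SetLike.mem_coe, Submodule.mem_iInf] at this
    simpa using this q hq
  have hHb : ∀ q ∈ Hh, ∀ v ∈ Vh, b v q = 0 := by
    intro q hq v hv
    have := hq.2
    simp only [SetLike.mem_coe, Submodule.mem_iInf] at this
    simpa using this v hv
  obtain ⟨u0, hu0, u1, hu1, rfl⟩ := Submodule.exists_add_mem_mem_orthogonal (K := K) u
  obtain ⟨p0, hp0, p1, hp1, rfl⟩ := Submodule.exists_add_mem_mem_orthogonal (K := Hh) p
  have hu1V : u1 ∈ Vh := by simpa using Vh.sub_mem hu (hKV hu0)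
  have hp1Q : p1 ∈ Qh := by simpa using Qh.sub_mem hp (hHQ hp0)
  obtain ⟨v, hv, hv1, hvb⟩ := hib p1 hp1Q hp1
  obtain ⟨q, hq, hq1, hqb⟩ := hiv u1 hu1V hu1
  set u := u0 + u1 with hu_def
  set p := p0 + p1 with hp_def
  have hbv : b v p = b v p1 := by simp [hp_def, hHb p0 hp0 v hv]
  have hbq : b u q = b u1 q := by simp [hu_def, hKb u0 hu0 q hq]
  have haub : ∀ w : V, a w w ≤ Na * ‖w‖ ^ 2 := by
    intro w
    have := (le_abs_self _).trans (aux_nrm a ha w w)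
    linarith [this, mul_assoc Na ‖w‖ ‖w‖, pow_two ‖w‖]
  have hcub : ∀ w : Q, c w w ≤ Nc * ‖w‖ ^ 2 := by
    intro w
    have := (le_abs_self _).trans (aux_nrm c hc w w)
    linarith [this, mul_assoc Nc ‖w‖ ‖w‖, pow_two ‖w‖]
  refine H ‖u0‖ ‖u1‖ ‖p0‖ ‖p1‖ D (a u u + c p p) (‖u‖ + ‖p‖) hD (by positivity)
    (add_nonneg (hap u) (hcp p)) ?_ ?_ ?_ ?_ ?_ ?_
  · have h1 : β * ‖p1‖ ≤ D + |a u v| := by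
      have h2 := (abs_le.1 (hF v hv)).2
      have h3 := neg_abs_le (a u v)
      have : D * ‖v‖ ≤ D := mul_le_of_le_one_right hD hv1
      linarith
    have h2 : (a u v) ^ 2 ≤ Na * (a u u + c p p) := by
      refine (aux_cs a has hap u v).trans ?_
      have h5 : a v v ≤ Na := (haub v).trans
        (mul_le_of_le_one_right hNa (pow_le_one₀ (norm_nonneg _) hv1))
      nlinarith [hap u, hcp p, mul_nonneg hNa (hcp p)]
    have h3 : (β * ‖p1‖) ^ 2 ≤ (D + |a u v|) ^ 2 := by gcongr
    nlinarith [sq_abs (a u v), sq_nonneg (D - |a u v|)]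
  · have h1 : β * ‖u1‖ ≤ D + |c p q| := by
      have h2 := (abs_le.1 (hG q hq)).2
      have h3 := le_abs_self (c p q)
      have : D * ‖q‖ ≤ D := mul_le_of_le_one_right hD hq1
      linarith
    have h2 : (c p q) ^ 2 ≤ Nc * (a u u + c p p) := by
      refine (aux_cs c hcs hcp p q).trans ?_
      have h5 : c q q ≤ Nc := (hcub q).trans
        (mul_le_of_le_one_right hNc (pow_le_one₀ (norm_nonneg _) hq1))
      nlinarith [hap u, hcp p, mul_nonneg hNc (hap u)]
    have h3 : (β * ‖u1‖) ^ 2 ≤ (D + |c p q|) ^ 2 := by gcongr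
    nlinarith [sq_abs (c p q), sq_nonneg (D - |c p q|)]
  · have h1 := hap (u + u1)
    have h2 : u0 = u - u1 := by simp [hu_def]
    have h3 := hKα u0 hu0
    have h4 : a u0 u0 + a (u + u1) (u + u1) = 2 * a u u + 2 * a u1 u1 := by
      rw [h2]; simp only [map_add, map_sub, _root_.add_apply,
        _root_.sub_apply]; ring
    linarith [haub u1, hcp p]
  · have h1 := hcp (p + p1)
    have h2 : p0 = p - p1 := by simp [hp_def]
    have h3 := hHγ p0 hp0
    have h4 : c p0 p0 + c (p + p1) (p + p1) = 2 * c p p + 2 * c p1 p1 := by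
      rw [h2]; simp only [map_add, map_sub, _root_.add_apply,
        _root_.sub_apply]; ring
    linarith [hcub p1, hap u]
  · have h1 := (abs_le.1 (hF u hu)).2
    have h2 := (abs_le.1 (hG p hp)).1
    linarith
  · have := norm_add_le u0 u1
    have := norm_add_le p0 p1
    linarith

lemma aux_gronwall (T B : ℝ) (hT : 0 < T) (hB : 0 ≤ B) (φ η : ℝ → ℝ)
    (hφi : IntervalIntegrable φ volume 0 T) (hηi : IntervalIntegrable η volume 0 T)
    (hη : ∀ t, 0 ≤ η t)
    (h : ∀ᵐ t ∂volume, t ∈ Set.Icc (0:ℝ) T → φ t ≤ η t + B * ∫ s in (0:ℝ)..t, φ s) :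
    ∫ t in (0:ℝ)..T, φ t ≤ Real.exp (B * T) * ∫ t in (0:ℝ)..T, η t := by
  set Φ : ℝ → ℝ := fun t => ∫ s in (0:ℝ)..t, φ s with hΦ
  set H := ∫ t in (0:ℝ)..T, η t with hH
  have hΦc : ContinuousOn Φ (Set.Icc 0 T) := by
    have := intervalIntegral.continuousOn_primitive_interval' hφi (a := 0) (by simp)
    rwa [Set.uIcc_of_le hT.le] at this
  have hΦi : IntervalIntegrable Φ volume 0 T :=
    ContinuousOn.intervalIntegrable (by rwa [Set.uIcc_of_le hT.le])
  have sub : ∀ t ∈ Set.Icc 0 T, Set.uIcc 0 t ⊆ Set.uIcc 0 T := by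
    intro t ht
    rw [Set.uIcc_of_le ht.1, Set.uIcc_of_le hT.le]
    exact Set.Icc_subset_Icc le_rfl ht.2
  have h1 : ∀ t ∈ Set.Icc 0 T, Φ t ≤ H + B * ∫ s in (0:ℝ)..t, Φ s := by
    intro t ht
    have i1 := hφi.mono_set (sub t ht)
    have i2 := hηi.mono_set (sub t ht)
    have i3 := hΦi.mono_set (sub t ht)
    have e1 : Φ t ≤ ∫ s in (0:ℝ)..t, (η s + B * Φ s) := by
      refine intervalIntegral.integral_mono_ae_restrict ht.1 i1 (i2.add (i3.const_mul B)) ?_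
      rw [Filter.EventuallyLE, ae_restrict_iff' measurableSet_Icc]
      filter_upwards [h] with s hs hs'
      exact hs ⟨hs'.1, hs'.2.trans ht.2⟩
    rw [intervalIntegral.integral_add i2 (i3.const_mul B), intervalIntegral.integral_const_mul] at e1
    have e2 : ∫ s in (0:ℝ)..t, η s ≤ H :=
      intervalIntegral.integral_mono_interval le_rfl ht.1 ht.2
        (Filter.Eventually.of_forall hη) hηi
    linarith
  have h2 : ∀ t ∈ Set.Icc 0 T, H + B * ∫ s in (0:ℝ)..t, Φ s ≤ gronwallBound H B 0 (t - 0) := by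
    refine le_gronwallBound_of_liminf_deriv_right_le (f' := fun t => B * Φ t) ?_ ?_ ?_ ?_
    · have := intervalIntegral.continuousOn_primitive_interval' hΦi (a := 0) (by simp)
      rw [Set.uIcc_of_le hT.le] at this
      exact continuousOn_const.add (continuousOn_const.mul this)
    · intro x hx r hr
      have hd : HasDerivWithinAt (fun t => H + B * ∫ s in (0:ℝ)..t, Φ s) (B * Φ x) (Set.Ici x) x := by
        have h3 : HasDerivWithinAt (fun t => ∫ s in (0:ℝ)..t, Φ s) (Φ x) (Set.Ici x) x := by
          have hcx : ContinuousWithinAt Φ (Set.Ioi x) x :=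
            ((hΦc x ⟨hx.1, hx.2.le⟩).mono_of_mem_nhdsWithin
              (Filter.mem_of_superset (Ioo_mem_nhdsGT hx.2)
                (fun y hy => ⟨hx.1.trans hy.1.le, hy.2.le⟩)))
          refine intervalIntegral.integral_hasDerivWithinAt_right
            (hΦi.mono_set (sub x ⟨hx.1, hx.2.le⟩)) (t := Set.Ioi x) ?_ hcx
          refine ⟨Set.Ioo x T, Ioo_mem_nhdsGT hx.2, ?_⟩
          exact (hΦc.mono (fun y hy => ⟨hx.1.trans hy.1.le, hy.2.le⟩)).aestronglyMeasurable
            measurableSet_Ioo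
        exact (h3.const_mul B).const_add H
      exact hd.liminf_right_slope_le hr
    · simp
    · intro x hx
      have := h1 x ⟨hx.1, hx.2.le⟩
      have := mul_le_mul_of_nonneg_left this hB
      linarith
  have h3 := (h1 T ⟨hT.le, le_rfl⟩).trans (h2 T ⟨hT.le, le_rfl⟩)
  rw [gronwallBound_ε0, sub_zero, mul_comm] at h3
  exact h3

noncomputable def auxD {E : Type} [NormedAddCommGroup E] [NormedSpace ℝ E]
    (A : ℝ → ℝ → E →L[ℝ] E) (F : ℝ → E) : ℕ → ℝ → E
  | 0 => F
  | (n + 1) => fun t => ∫ s, A t s (auxD A F n s)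

lemma aux_volterra {E : Type} [NormedAddCommGroup E] [NormedSpace ℝ E] [CompleteSpace E]
    (T R : ℝ) (hT : 0 < T) (hR : 0 < R) (A : ℝ → ℝ → E →L[ℝ] E)
    (hA : StronglyMeasurable (Function.uncurry A)) (hAb : ∀ t s, ‖A t s‖ ≤ R)
    (hA0 : ∀ t s, ¬ (0 < s ∧ s ≤ t ∧ t ≤ T) → A t s = 0)
    (F : ℝ → E) (hF : StronglyMeasurable F) (hFi : Integrable F) :
    ∃ x : ℝ → E, StronglyMeasurable x ∧ IntervalIntegrable x volume 0 T ∧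
      (∀ t, Integrable (fun s => A t s (x s))) ∧ ∀ t, x t = F t + ∫ s, A t s (x s) := by
  have hm2 : ∀ y : ℝ → E, StronglyMeasurable y →
      StronglyMeasurable (fun z : ℝ × ℝ => A z.1 z.2 (y z.2)) := by
    intro y hy
    exact (isBoundedBilinearMap_apply (𝕜 := ℝ) (E := E) (F := E)).continuous.comp_stronglyMeasurable
      (hA.prodMk (hy.comp_measurable measurable_snd))
  have hm1 : ∀ y : ℝ → E, StronglyMeasurable y → ∀ t,
      StronglyMeasurable (fun s : ℝ => A t s (y s)) := by
    intro y hy t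
    exact (hm2 y hy).comp_measurable (measurable_const.prodMk measurable_id : Measurable (fun s : ℝ => (t, s)))
  have hD : ∀ n, StronglyMeasurable (auxD A F n) := by
    intro n
    induction n with
    | zero => exact hF
    | succ n ih => exact (hm2 _ ih).integral_prod_right
  have hle : ∀ t s y, ‖A t s y‖ ≤ R * ‖y‖ := fun t s y =>
    ((A t s).le_opNorm y).trans (by gcongr; exact hAb t s)
  set m := ∫ s, ‖F s‖ with hm
  have hm0 : 0 ≤ m := integral_nonneg (fun _ => norm_nonneg _)
  have hz : ∀ n t, ¬ (0 < t ∧ t ≤ T) → auxD A F (n+1) t = 0 := by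
    intro n t ht
    have : ∀ s, A t s = 0 := fun s => hA0 t s (fun h => ht ⟨h.1.trans_le h.2.1, h.2.2⟩)
    simp [auxD, this]
  have hb : ∀ n t, ‖auxD A F (n+1) t‖ ≤ R * m * (1/2)^n * Real.exp (2 * R * t) := by
    intro n
    induction n with
    | zero =>
      intro t
      by_cases ht : 0 < t ∧ t ≤ T
      · have h1 : ‖auxD A F 1 t‖ ≤ ∫ s, R * ‖F s‖ :=
          norm_integral_le_of_norm_le (hFi.norm.const_mul R)
            (Filter.Eventually.of_forall fun s => hle t s _)
        rw [integral_const_mul] at h1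
        have h2 : 1 ≤ Real.exp (2 * R * t) := Real.one_le_exp (by have := ht.1; positivity)
        have : R * m * 1 ≤ R * m * Real.exp (2 * R * t) := by gcongr
        simp only [pow_zero, mul_one, zero_add] at this ⊢
        linarith
      · rw [hz 0 t ht]; simp only [norm_zero]; positivity
    | succ n ih =>
      intro t
      by_cases ht : 0 < t ∧ t ≤ T
      · have e : auxD A F (n+1+1) t = ∫ s in (0:ℝ)..t, A t s (auxD A F (n+1) s) := by
          rw [intervalIntegral.integral_of_le ht.1.le]
          refine (setIntegral_eq_integral_of_forall_compl_eq_zero ?_).symm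
          intro s hs
          rw [hA0 t s (fun h => hs ⟨h.1, h.2.1⟩)]; simp
        have h1 : ‖∫ s in (0:ℝ)..t, A t s (auxD A F (n+1) s)‖ ≤
            ∫ s in (0:ℝ)..t, R * (R * m * (1/2)^n) * Real.exp (2 * R * s) := by
          refine intervalIntegral.norm_integral_le_of_norm_le ht.1.le ?_ ?_
          · refine Filter.Eventually.of_forall fun s _ => (hle t s _).trans ?_
            have := ih s
            calc _ ≤ R * (R * m * (1/2)^n * Real.exp (2 * R * s)) := by gcongr
              _ = _ := by ring
          · apply Continuous.intervalIntegrable; fun_prop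
        have h2 : ∫ s in (0:ℝ)..t, Real.exp (2 * R * s) = (Real.exp (2 * R * t) - 1) / (2 * R) := by
          rw [intervalIntegral.integral_comp_mul_left (fun x => Real.exp x) (by positivity)]
          simp; ring
        rw [intervalIntegral.integral_const_mul, h2, ← e] at h1
        refine h1.trans ?_
        have e3 : R * (R * m * (1/2)^n) * ((Real.exp (2 * R * t) - 1) / (2 * R)) =
          R * m * (1/2)^(n+1) * (Real.exp (2 * R * t) - 1) := by
            field_simp; ring
        rw [e3]
        gcongr
        linarith
      · rw [hz _ t ht]; simp only [norm_zero]; positivity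
  set b : ℕ → ℝ := fun n => R * m * Real.exp (2 * R * T) * (1/2)^n with hbdef
  have hbs : Summable b := (summable_geometric_of_lt_one (by norm_num) (by norm_num)).mul_left _
  have hb0 : ∀ n, 0 ≤ b n := fun n => by positivity
  have hb' : ∀ n t, ‖auxD A F (n+1) t‖ ≤ b n := by
    intro n t
    by_cases ht : 0 < t ∧ t ≤ T
    · refine (hb n t).trans ?_
      calc _ ≤ R * m * (1/2)^n * Real.exp (2 * R * T) := by gcongr; exact ht.2
        _ = _ := by rw [hbdef]; ring
    · rw [hz _ t ht, norm_zero]; exact hb0 n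
  have hsum : ∀ t, Summable (fun n => auxD A F (n+1) t) := fun t =>
    Summable.of_norm_bounded hbs (fun n => hb' n t)
  set S : ℝ → E := fun t => ∑' n, auxD A F (n+1) t with hS
  have hSm : StronglyMeasurable S := by
    refine stronglyMeasurable_of_tendsto (u := Filter.atTop)
      (f := fun N t => ∑ n ∈ Finset.range N, auxD A F (n+1) t) ?_ ?_
    · intro N
      exact Finset.stronglyMeasurable_fun_sum _ (fun n _ => hD (n+1))
    · rw [tendsto_pi_nhds]
      intro t
      exact (hsum t).hasSum.tendsto_sum_nat
  have hSb : ∀ t, ‖S t‖ ≤ ∑' n, b n := fun t => tsum_of_norm_bounded hbs.hasSum (fun n => hb' n t)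
  -- integrability of bounded functions against the kernel
  have hint : ∀ (y : ℝ → E) (C : ℝ), 0 ≤ C → StronglyMeasurable y → (∀ s, ‖y s‖ ≤ C) → ∀ t,
      Integrable (fun s => A t s (y s)) ∧ ∫ s, ‖A t s (y s)‖ ≤ T * (R * C) := by
    intro y C hC hy hyC t
    have hI : Integrable ((Set.Ioc 0 T).indicator (fun _ : ℝ => R * C)) := by
      rw [integrable_indicator_iff measurableSet_Ioc]
      exact integrableOn_const (by simp)
    have hp : ∀ s, ‖A t s (y s)‖ ≤ (Set.Ioc 0 T).indicator (fun _ : ℝ => R * C) s := by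
      intro s
      by_cases hs : s ∈ Set.Ioc 0 T
      · rw [Set.indicator_of_mem hs]
        exact (hle t s _).trans (by gcongr; exact hyC s)
      · rw [Set.indicator_of_notMem hs, hA0 t s (fun h => hs ⟨h.1, h.2.1.trans h.2.2⟩)]; simp
    have h1 : Integrable (fun s => A t s (y s)) :=
      hI.mono' (hm1 y hy t).aestronglyMeasurable (Filter.Eventually.of_forall hp)
    refine ⟨h1, (integral_mono h1.norm hI hp).trans ?_⟩
    rw [integral_indicator measurableSet_Ioc]
    simp [hT.le]
  have hFA : ∀ t, Integrable (fun s => A t s (F s)) := fun t =>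
    (hFi.norm.const_mul R).mono' (hm1 F hF t).aestronglyMeasurable
      (Filter.Eventually.of_forall fun s => hle t s _)
  have hSA := fun t => (hint S _ (tsum_nonneg hb0) hSm hSb t).1
  refine ⟨fun t => F t + S t, hF.add hSm, ?_, ?_, ?_⟩
  · refine IntervalIntegrable.add hFi.intervalIntegrable ?_
    refine (intervalIntegrable_const (c := ∑' n, b n)).mono_fun hSm.aestronglyMeasurable ?_
    refine Filter.Eventually.of_forall fun t => (hSb t).trans (le_abs_self _)
  · intro t
    simp only [map_add]
    exact (hFA t).add (hSA t)
  · intro t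
    simp only [map_add]
    rw [integral_add (hFA t) (hSA t)]
    have h1 : ∫ s, A t s (S s) = ∑' n, auxD A F (n+2) t := by
      have h2 : ∀ s, A t s (S s) = ∑' n, A t s (auxD A F (n+1) s) := fun s =>
        (A t s).map_tsum (hsum s)
      simp_rw [h2]
      rw [← integral_tsum_of_summable_integral_norm]
      · rfl
      · intro n; exact (hint _ _ (hb0 n) (hD (n+1)) (hb' n) t).1
      · refine Summable.of_nonneg_of_le (fun n => integral_nonneg fun _ => norm_nonneg _)
          (fun n => (hint _ _ (hb0 n) (hD (n+1)) (hb' n) t).2) ?_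
        exact (hbs.mul_left R).mul_left T
    rw [h1]
    exact congrArg (F t + ·) (hsum t).tsum_eq_zero_add

lemma aux_ker_ae (T C : ℝ) (k : ℝ → ℝ → ℝ)
    (h : ∀ᵐ ts : ℝ × ℝ ∂volume, 0 ≤ ts.2 → ts.2 ≤ ts.1 → ts.1 ≤ T → |k ts.1 ts.2| ≤ C) :
    ∀ᵐ t : ℝ, t ∈ Set.Icc (0:ℝ) T → ∀ᵐ s : ℝ, s ∈ Set.Ioc 0 t → |k t s| ≤ C := by
  rw [Measure.volume_eq_prod] at h
  filter_upwards [Measure.ae_ae_of_ae_prod h] with t ht htT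
  filter_upwards [ht] with s hs hst
  exact hs hst.1.le hst.2 htT.2

lemma aux_ker_int {t C : ℝ} (ht : 0 ≤ t) {k y : ℝ → ℝ} (hk : Measurable k)
    (hkC : ∀ᵐ s : ℝ, s ∈ Set.Ioc 0 t → |k s| ≤ C) (hy : IntervalIntegrable y volume 0 t) :
    IntervalIntegrable (fun s => k s * y s) volume 0 t := by
  rw [intervalIntegrable_iff_integrableOn_Ioc_of_le ht] at hy ⊢
  refine Integrable.bdd_mul (c := C) hy hk.aestronglyMeasurable ?_
  rw [ae_restrict_iff' measurableSet_Ioc]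
  exact hkC

lemma aux_clm_int {V : Type} [NormedAddCommGroup V] [NormedSpace ℝ V] {t : ℝ} (l : V →L[ℝ] ℝ)
    {y : ℝ → V} (hy : IntervalIntegrable y volume 0 t) :
    IntervalIntegrable (fun s => l (y s)) volume 0 t :=
  ⟨l.integrable_comp hy.1, l.integrable_comp hy.2⟩

lemma aux_diff {V Q : Type} [NormedAddCommGroup V] [NormedSpace ℝ V]
    [NormedAddCommGroup Q] [NormedSpace ℝ Q] {t C C' C0 N : ℝ} (ht : 0 ≤ t) {k k' : ℝ → ℝ}
    (hk : Measurable k) (hk' : Measurable k')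
    (hkC : ∀ᵐ s : ℝ, s ∈ Set.Ioc 0 t → |k s| ≤ C) (hkC' : ∀ᵐ s : ℝ, s ∈ Set.Ioc 0 t → |k' s| ≤ C')
    (hC : C ≤ C0) (hC' : C' ≤ C0) (hC0 : 0 ≤ C0) 
    (l : V →L[ℝ] ℝ) (l' : Q →L[ℝ] ℝ) (hl : ∀ x, |l x| ≤ N * ‖x‖) (hl' : ∀ x, |l' x| ≤ N * ‖x‖)
    {x x' : ℝ → V} {y y' : ℝ → Q} (hx : IntervalIntegrable x volume 0 t)
    (hx' : IntervalIntegrable x' volume 0 t) (hy : IntervalIntegrable y volume 0 t)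
    (hy' : IntervalIntegrable y' volume 0 t) :
    |(∫ s in (0:ℝ)..t, (k s * l (x s) + k' s * l' (y s))) -
      ∫ s in (0:ℝ)..t, (k s * l (x' s) + k' s * l' (y' s))| ≤
      C0 * N * ∫ s in (0:ℝ)..t, (‖x s - x' s‖ + ‖y s - y' s‖) := by
  have i1 := (aux_ker_int ht hk hkC (aux_clm_int l hx)).add
    (aux_ker_int ht hk' hkC' (aux_clm_int l' hy))
  have i2 := (aux_ker_int ht hk hkC (aux_clm_int l hx')).add
    (aux_ker_int ht hk' hkC' (aux_clm_int l' hy'))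
  have e := intervalIntegral.integral_sub i1 i2
  rw [← e, ← intervalIntegral.integral_const_mul, ← Real.norm_eq_abs]
  refine intervalIntegral.norm_integral_le_of_norm_le ht ?_
    (((hx.sub hx').norm.add (hy.sub hy').norm).const_mul _)
  filter_upwards [hkC, hkC'] with s h1 h2 hs
  have e1 : k s * l (x s) + k' s * l' (y s) - (k s * l (x' s) + k' s * l' (y' s)) =
    k s * l (x s - x' s) + k' s * l' (y s - y' s) := by simp only [map_sub]; ring
  rw [e1, Real.norm_eq_abs]
  refine (abs_add_le _ _).trans ?_
  rw [abs_mul, abs_mul]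
  have g1 : |k s| * |l (x s - x' s)| ≤ C0 * (N * ‖x s - x' s‖) :=
    mul_le_mul ((h1 hs).trans hC) (hl _) (abs_nonneg _) hC0
  have g2 : |k' s| * |l' (y s - y' s)| ≤ C0 * (N * ‖y s - y' s‖) :=
    mul_le_mul ((h2 hs).trans hC') (hl' _) (abs_nonneg _) hC0
  linarith

lemma aux_error {V Q : Type} [NormedAddCommGroup V] [InnerProductSpace ℝ V]
    [NormedAddCommGroup Q] [InnerProductSpace ℝ Q]
    (M Na Nb Nc Ck1 Ck2 Ck3 Ck4 T : ℝ) (hM : 0 < M) (hT : 0 < T)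
    (hNa : 0 ≤ Na) (hNb : 0 ≤ Nb) (hNc : 0 ≤ Nc)
    (hCk1 : 0 ≤ Ck1) (hCk2 : 0 ≤ Ck2) (hCk3 : 0 ≤ Ck3) (hCk4 : 0 ≤ Ck4)
    (a : V →L[ℝ] V →L[ℝ] ℝ) (b : V →L[ℝ] Q →L[ℝ] ℝ) (c : Q →L[ℝ] Q →L[ℝ] ℝ)
    (k₁ k₂ k₃ k₄ : ℝ → ℝ → ℝ) (ha : ‖a‖ ≤ Na) (hb : ‖b‖ ≤ Nb) (hc : ‖c‖ ≤ Nc)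
    (hm1 : Measurable (Function.uncurry k₁)) (hm2 : Measurable (Function.uncurry k₂))
    (hm3 : Measurable (Function.uncurry k₃)) (hm4 : Measurable (Function.uncurry k₄))
    (h1 : ∀ᵐ ts : ℝ × ℝ ∂volume,
      0 ≤ ts.2 → ts.2 ≤ ts.1 → ts.1 ≤ T → |k₁ ts.1 ts.2| ≤ Ck1)
    (h2 : ∀ᵐ ts : ℝ × ℝ ∂volume,
      0 ≤ ts.2 → ts.2 ≤ ts.1 → ts.1 ≤ T → |k₂ ts.1 ts.2| ≤ Ck2)
    (h3 : ∀ᵐ ts : ℝ × ℝ ∂volume,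
      0 ≤ ts.2 → ts.2 ≤ ts.1 → ts.1 ≤ T → |k₃ ts.1 ts.2| ≤ Ck3)
    (h4 : ∀ᵐ ts : ℝ × ℝ ∂volume,
      0 ≤ ts.2 → ts.2 ≤ ts.1 → ts.1 ≤ T → |k₄ ts.1 ts.2| ≤ Ck4)
    (Vh : Submodule ℝ V) (Qh : Submodule ℝ Q)
    (hst : ∀ u ∈ Vh, ∀ p ∈ Qh, ∀ D : ℝ, 0 ≤ D →
          (∀ v ∈ Vh, |a u v + b v p| ≤ D * ‖v‖) → (∀ q ∈ Qh, |b u q - c p q| ≤ D * ‖q‖) →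
          ‖u‖ + ‖p‖ ≤ M * D)
    (f : ℝ → V →L[ℝ] ℝ) (g : ℝ → Q →L[ℝ] ℝ)
    (uh u v : ℝ → V) (ph p q : ℝ → Q)
    (huh : ∀ t, uh t ∈ Vh) (hph : ∀ t, ph t ∈ Qh) (hv : ∀ t, v t ∈ Vh) (hq : ∀ t, q t ∈ Qh)
    (iuh : IntervalIntegrable uh volume 0 T) (iph : IntervalIntegrable ph volume 0 T)
    (iu : IntervalIntegrable u volume 0 T) (ip : IntervalIntegrable p volume 0 T)
    (iv : IntervalIntegrable v volume 0 T) (iq : IntervalIntegrable q volume 0 T)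
    (Sh : SolvesPOn V Q T a b c k₁ k₂ k₃ k₄ f g Vh Qh uh ph)
    (S : SolvesPOn V Q T a b c k₁ k₂ k₃ k₄ f g Vh Qh u p) :
    (∫ t in (0:ℝ)..T, ‖uh t - u t‖) + (∫ t in (0:ℝ)..T, ‖ph t - p t‖)
      ≤ (Real.exp (M * ((Ck1 + Ck2 + Ck3 + Ck4) * (Na + Nb + Nc)) * T) * (1 + M * (Na + Nb + Nc))) *
          ((∫ t in (0:ℝ)..T, ‖u t - v t‖) + ∫ t in (0:ℝ)..T, ‖p t - q t‖) := by
  set N := Na + Nb + Nc with hN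
  set C0 := Ck1 + Ck2 + Ck3 + Ck4 with hC0
  have hN0 : 0 ≤ N := by positivity
  have hC00 : 0 ≤ C0 := by positivity
  have j1 := (iuh.sub iu).norm
  have j2 := (iph.sub ip).norm
  have j3 := (iu.sub iv).norm
  have j4 := (ip.sub iq).norm
  rw [← intervalIntegral.integral_add j1 j2, ← intervalIntegral.integral_add j3 j4, mul_assoc,
    ← intervalIntegral.integral_const_mul]
  refine aux_gronwall T (M * (C0 * N)) hT (by positivity) _ _ (j1.add j2)
    ((j3.add j4).const_mul _) (fun t => by positivity) ?_
  filter_upwards [Sh, S, aux_ker_ae T Ck1 k₁ h1, aux_ker_ae T Ck2 k₂ h2, aux_ker_ae T Ck3 k₃ h3,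
    aux_ker_ae T Ck4 k₄ h4] with t hSh hS r1 r2 r3 r4 ht
  obtain ⟨A1, A2⟩ := hSh ht
  obtain ⟨B1, B2⟩ := hS ht
  have sub : Set.uIcc 0 t ⊆ Set.uIcc 0 T := by
    rw [Set.uIcc_of_le ht.1, Set.uIcc_of_le hT.le]
    exact Set.Icc_subset_Icc le_rfl ht.2
  have iuh' := iuh.mono_set sub
  have iph' := iph.mono_set sub
  have iu' := iu.mono_set sub
  have ip' := ip.mono_set sub
  have mk : ∀ k : ℝ → ℝ → ℝ, Measurable (Function.uncurry k) → Measurable (k t) := fun k hk =>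
    hk.comp (measurable_const.prodMk measurable_id : Measurable (fun s : ℝ => (t, s)))
  set Φ := ∫ s in (0:ℝ)..t, (‖uh s - u s‖ + ‖ph s - p s‖) with hΦ
  have hΦ0 : 0 ≤ Φ := intervalIntegral.integral_nonneg ht.1 (fun s _ => by positivity)
  set D := N * (‖u t - v t‖ + ‖p t - q t‖) + C0 * N * Φ with hD
  have key : ‖uh t - v t‖ + ‖ph t - q t‖ ≤ M * D := by
    refine hst _ (Vh.sub_mem (huh t) (hv t)) _ (Qh.sub_mem (hph t) (hq t)) D (by positivity) ?_ ?_
    · intro w hw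
      have d := aux_diff (C0 := C0) (N := N * ‖w‖) ht.1 (mk _ hm1) (mk _ hm2) (r1 ht) (r2 ht)
        (by linarith) (by linarith) hC00 (a.flip w) (b w)
        (fun x => ?_) (fun x => ?_) iuh' iu' iph' ip'
      · simp only [ContinuousLinearMap.flip_apply] at d
        have e1 := A1 w hw
        have e2 := B1 w hw
        have e3 : a (uh t - v t) w + b w (ph t - q t) =
          a (u t - v t) w + b w (p t - q t) + 
          ((∫ s in (0:ℝ)..t, (k₁ t s * a (uh s) w + k₂ t s * b w (ph s))) -
            ∫ s in (0:ℝ)..t, (k₁ t s * a (u s) w + k₂ t s * b w (p s))) := by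
          simp only [map_sub, _root_.sub_apply]
          linarith
        rw [e3]
        refine (abs_add_le _ _).trans ?_
        have g1 := aux_nrm a ha (u t - v t) w
        have g2 := aux_nrm b hb w (p t - q t)
        have g3 := abs_add_le (a (u t - v t) w) (b w (p t - q t))
        have g4 : Na * ‖u t - v t‖ * ‖w‖ ≤ N * ‖u t - v t‖ * ‖w‖ := by gcongr; linarith
        have g5 : Nb * ‖w‖ * ‖p t - q t‖ ≤ N * ‖w‖ * ‖p t - q t‖ := by gcongr; linarith
        rw [hD]
        linarith
      · refine (aux_nrm a ha x w).trans ?_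
        have : Na * ‖x‖ * ‖w‖ ≤ N * ‖x‖ * ‖w‖ := by gcongr; linarith
        linarith
      · refine (aux_nrm b hb w x).trans ?_
        gcongr; linarith
    · intro w hw
      have d := aux_diff (C0 := C0) (N := N * ‖w‖) ht.1 (mk _ hm3) (mk _ hm4) (r3 ht) (r4 ht)
        (by linarith) (by linarith) hC00 (b.flip w) (-(c.flip w))
        (fun x => ?_) (fun x => ?_) iuh' iu' iph' ip'
      · simp only [ContinuousLinearMap.flip_apply, _root_.neg_apply, mul_neg, ← sub_eq_add_neg] at d
        have e1 := A2 w hw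
        have e2 := B2 w hw
        have e3 : b (uh t - v t) w - c (ph t - q t) w =
          b (u t - v t) w - c (p t - q t) w + 
          ((∫ s in (0:ℝ)..t, (k₃ t s * b (uh s) w - k₄ t s * c (ph s) w)) -
            ∫ s in (0:ℝ)..t, (k₃ t s * b (u s) w - k₄ t s * c (p s) w)) := by
          simp only [map_sub, _root_.sub_apply]
          linarith
        rw [e3]
        refine (abs_add_le _ _).trans ?_
        have g1 := aux_nrm b hb (u t - v t) w
        have g2 := aux_nrm c hc (p t - q t) w
        have g3 := abs_sub (b (u t - v t) w) (c (p t - q t) w)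
        have g4 : Nb * ‖u t - v t‖ * ‖w‖ ≤ N * ‖u t - v t‖ * ‖w‖ := by gcongr; linarith
        have g5 : Nc * ‖p t - q t‖ * ‖w‖ ≤ N * ‖p t - q t‖ * ‖w‖ := by gcongr; linarith
        rw [hD]
        linarith
      · refine (aux_nrm b hb x w).trans ?_
        have : Nb * ‖x‖ * ‖w‖ ≤ N * ‖x‖ * ‖w‖ := by gcongr; linarith
        linarith
      · simp only [ContinuousLinearMap.flip_apply, _root_.neg_apply, abs_neg]
        refine (aux_nrm c hc x w).trans ?_
        have : Nc * ‖x‖ * ‖w‖ ≤ N * ‖x‖ * ‖w‖ := by gcongr; linarith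
        linarith
  have t1 : ‖uh t - u t‖ ≤ ‖uh t - v t‖ + ‖u t - v t‖ := by
    rw [norm_sub_rev (u t)]; exact norm_sub_le_norm_sub_add_norm_sub _ _ _
  have t2 : ‖ph t - p t‖ ≤ ‖ph t - q t‖ + ‖p t - q t‖ := by
    rw [norm_sub_rev (p t)]; exact norm_sub_le_norm_sub_add_norm_sub _ _ _
  rw [hD] at key
  linarith

open Classical in
/-- Truncated kernel. -/
noncomputable def auxK (T C : ℝ) (k : ℝ → ℝ → ℝ) (t s : ℝ) : ℝ :=
  if (0 < s ∧ s ≤ t ∧ t ≤ T) ∧ |k t s| ≤ C then k t s else 0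

lemma auxK_meas (T C : ℝ) (k : ℝ → ℝ → ℝ) (hk : Measurable (Function.uncurry k)) :
    Measurable (fun z : ℝ × ℝ => auxK T C k z.1 z.2) := by
  unfold auxK
  refine Measurable.ite ?_ hk measurable_const
  refine MeasurableSet.inter (MeasurableSet.inter ?_ (MeasurableSet.inter ?_ ?_)) ?_
  · exact measurableSet_lt measurable_const measurable_snd
  · exact measurableSet_le measurable_snd measurable_fst
  · exact measurableSet_le measurable_fst measurable_const
  · exact measurableSet_le (_root_.continuous_abs.measurable.comp hk) measurable_const

lemma auxK_le (T C : ℝ) (hC : 0 ≤ C) (k : ℝ → ℝ → ℝ) (t s : ℝ) : |auxK T C k t s| ≤ C := by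
  unfold auxK
  split_ifs with h
  · exact h.2
  · simpa using hC

lemma auxK_zero (T C : ℝ) (k : ℝ → ℝ → ℝ) (t s : ℝ) (h : ¬ (0 < s ∧ s ≤ t ∧ t ≤ T)) :
    auxK T C k t s = 0 := by
  unfold auxK
  rw [if_neg (fun h' => h h'.1)]

lemma auxK_int (T C C' : ℝ) (k k' : ℝ → ℝ → ℝ) (t : ℝ) (ht : t ∈ Set.Icc (0:ℝ) T)
    (hk : ∀ᵐ s : ℝ, s ∈ Set.Ioc 0 t → |k t s| ≤ C)
    (hk' : ∀ᵐ s : ℝ, s ∈ Set.Ioc 0 t → |k' t s| ≤ C') (y z : ℝ → ℝ) :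
    ∫ s, (auxK T C k t s * y s + auxK T C' k' t s * z s) =
      ∫ s in (0:ℝ)..t, (k t s * y s + k' t s * z s) := by
  rw [intervalIntegral.integral_of_le ht.1,
    ← setIntegral_eq_integral_of_forall_compl_eq_zero (s := Set.Ioc 0 t)]
  · refine setIntegral_congr_ae measurableSet_Ioc ?_
    filter_upwards [hk, hk'] with s h1 h2 hs
    unfold auxK
    rw [if_pos ⟨⟨hs.1, hs.2, ht.2⟩, h1 hs⟩, if_pos ⟨⟨hs.1, hs.2, ht.2⟩, h2 hs⟩]
  · intro s hs
    have : ¬ (0 < s ∧ s ≤ t ∧ t ≤ T) := fun h => hs ⟨h.1, h.2.1⟩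
    rw [auxK_zero _ _ _ _ _ this, auxK_zero _ _ _ _ _ this]; simp

lemma aux_volterra2 {E G : Type} [NormedAddCommGroup E] [NormedSpace ℝ E] [CompleteSpace E]
    [NormedAddCommGroup G] [NormedSpace ℝ G]
    (Ck1 Ck2 Ck3 Ck4 T : ℝ) (hT : 0 < T)
    (hCk1 : 0 ≤ Ck1) (hCk2 : 0 ≤ Ck2) (hCk3 : 0 ≤ Ck3) (hCk4 : 0 ≤ Ck4)
    (k₁ k₂ k₃ k₄ : ℝ → ℝ → ℝ)
    (hm1 : Measurable (Function.uncurry k₁)) (hm2 : Measurable (Function.uncurry k₂))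
    (hm3 : Measurable (Function.uncurry k₃)) (hm4 : Measurable (Function.uncurry k₄))
    (K1 K2 K3 K4 L : E →L[ℝ] G) (Li : G →L[ℝ] E) (hLi : ∀ y, L (Li y) = y)
    (φ : ℝ → G) (hφ : IntegrableOn φ (Set.Ioc 0 T)) :
    ∃ x : ℝ → E, IntervalIntegrable x volume 0 T ∧
      ∀ᵐ t : ℝ, t ∈ Set.Ioc 0 T → ∀ ψ : G →L[ℝ] ℝ, ψ (L (x t)) = ψ (φ t) +
        ∫ s, (auxK T Ck1 k₁ t s * ψ (K1 (x s)) + auxK T Ck2 k₂ t s * ψ (K2 (x s)) +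
          auxK T Ck3 k₃ t s * ψ (K3 (x s)) + auxK T Ck4 k₄ t s * ψ (K4 (x s))) := by
  let A : ℝ → ℝ → E →L[ℝ] E := fun t s =>
    auxK T Ck1 k₁ t s • (Li ∘L K1) + auxK T Ck2 k₂ t s • (Li ∘L K2) +
      auxK T Ck3 k₃ t s • (Li ∘L K3) + auxK T Ck4 k₄ t s • (Li ∘L K4)
  have hAm : StronglyMeasurable (Function.uncurry A) :=
    ((((auxK_meas T Ck1 k₁ hm1).stronglyMeasurable.smul_const (Li ∘L K1)).add
      ((auxK_meas T Ck2 k₂ hm2).stronglyMeasurable.smul_const (Li ∘L K2))).add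
      ((auxK_meas T Ck3 k₃ hm3).stronglyMeasurable.smul_const (Li ∘L K3))).add
      ((auxK_meas T Ck4 k₄ hm4).stronglyMeasurable.smul_const (Li ∘L K4))
  have hsm : ∀ (C : ℝ) (k : ℝ → ℝ → ℝ) (hC : 0 ≤ C) (t s : ℝ)
      (W : E →L[ℝ] E), ‖auxK T C k t s • W‖ ≤ C * ‖W‖ := by
    intro C k hC t s W
    rw [norm_smul, Real.norm_eq_abs]
    gcongr
    exact auxK_le T C hC k t s
  have hint : IntegrableOn (fun t => Li (φ t)) (Set.Ioc 0 T) := Li.integrable_comp hφ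
  obtain ⟨x, hxm, hxi, hxI, hx⟩ := aux_volterra T
    (Ck1 * ‖Li ∘L K1‖ + Ck2 * ‖Li ∘L K2‖ + Ck3 * ‖Li ∘L K3‖ + Ck4 * ‖Li ∘L K4‖ + 1) hT
    (by positivity) A hAm (by
      intro t s
      refine (norm_add₄_le).trans ?_
      linarith [hsm Ck1 k₁ hCk1 t s (Li ∘L K1), hsm Ck2 k₂ hCk2 t s (Li ∘L K2),
        hsm Ck3 k₃ hCk3 t s (Li ∘L K3), hsm Ck4 k₄ hCk4 t s (Li ∘L K4)])
    (by
      intro t s h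
      simp only [A, auxK_zero _ _ _ _ _ h, zero_smul, add_zero])
    ((Set.Ioc 0 T).indicator (hint.1.mk _))
    ((AEStronglyMeasurable.stronglyMeasurable_mk _).indicator measurableSet_Ioc)
    (by
      rw [integrable_indicator_iff measurableSet_Ioc]
      exact hint.congr (AEStronglyMeasurable.ae_eq_mk _))
  have hmk := hint.1.ae_eq_mk
  rw [Filter.EventuallyEq, ae_restrict_iff' measurableSet_Ioc] at hmk
  refine ⟨x, hxi, ?_⟩
  filter_upwards [hmk] with t hF htI ψ
  have hxt : x t = Li (φ t) + ∫ s, A t s (x s) := by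
    rw [hx t, Set.indicator_of_mem htI, ← hF htI]
  have h1 : ψ (L (x t)) = ψ (L (Li (φ t))) + ∫ s, (ψ ∘L L) (A t s (x s)) := by
    rw [(ψ ∘L L).integral_comp_comm (hxI t), ContinuousLinearMap.comp_apply, ← map_add, ← map_add,
      ← hxt]
  rw [h1, hLi]
  congr 2
  ext s
  have : A t s (x s) = Li (auxK T Ck1 k₁ t s • K1 (x s) + auxK T Ck2 k₂ t s • K2 (x s) +
      auxK T Ck3 k₃ t s • K3 (x s) + auxK T Ck4 k₄ t s • K4 (x s)) := by
    simp only [map_add, map_smul]; rfl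
  rw [ContinuousLinearMap.comp_apply, this, hLi]
  simp only [map_add, map_smul, smul_eq_mul]

lemma aux_comp_int {E G : Type} [NormedAddCommGroup E] [NormedSpace ℝ E]
    [NormedAddCommGroup G] [NormedSpace ℝ G] {μ : Measure ℝ} (l : E →L[ℝ] G) {φ : ℝ → E}
    (h : Integrable φ μ) : Integrable (fun t => l (φ t)) μ := l.integrable_comp h

lemma aux_exist0 {V Q : Type} [NormedAddCommGroup V] [InnerProductSpace ℝ V]
    [NormedAddCommGroup Q] [InnerProductSpace ℝ Q]
    {W P : Type} [NormedAddCommGroup W] [NormedSpace ℝ W] [FiniteDimensional ℝ W]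
    [NormedAddCommGroup P] [NormedSpace ℝ P] [FiniteDimensional ℝ P]
    (iV : W →L[ℝ] V) (iQ : P →L[ℝ] Q)
    (Ck1 Ck2 Ck3 Ck4 T : ℝ) (hT : 0 < T)
    (hCk1 : 0 ≤ Ck1) (hCk2 : 0 ≤ Ck2) (hCk3 : 0 ≤ Ck3) (hCk4 : 0 ≤ Ck4)
    (a : V →L[ℝ] V →L[ℝ] ℝ) (b : V →L[ℝ] Q →L[ℝ] ℝ) (c : Q →L[ℝ] Q →L[ℝ] ℝ)
    (k₁ k₂ k₃ k₄ : ℝ → ℝ → ℝ)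
    (hm1 : Measurable (Function.uncurry k₁)) (hm2 : Measurable (Function.uncurry k₂))
    (hm3 : Measurable (Function.uncurry k₃)) (hm4 : Measurable (Function.uncurry k₄))
    (h1 : ∀ᵐ ts : ℝ × ℝ ∂volume,
      0 ≤ ts.2 → ts.2 ≤ ts.1 → ts.1 ≤ T → |k₁ ts.1 ts.2| ≤ Ck1)
    (h2 : ∀ᵐ ts : ℝ × ℝ ∂volume,
      0 ≤ ts.2 → ts.2 ≤ ts.1 → ts.1 ≤ T → |k₂ ts.1 ts.2| ≤ Ck2)
    (h3 : ∀ᵐ ts : ℝ × ℝ ∂volume,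
      0 ≤ ts.2 → ts.2 ≤ ts.1 → ts.1 ≤ T → |k₃ ts.1 ts.2| ≤ Ck3)
    (h4 : ∀ᵐ ts : ℝ × ℝ ∂volume,
      0 ≤ ts.2 → ts.2 ≤ ts.1 → ts.1 ≤ T → |k₄ ts.1 ts.2| ≤ Ck4)
    (hst : ∀ w p, (∀ w', a (iV w) (iV w') + b (iV w') (iQ p) = 0) →
      (∀ p', b (iV w) (iQ p') - c (iQ p) (iQ p') = 0) → w = 0 ∧ p = 0)
    (f : ℝ → V →L[ℝ] ℝ) (g : ℝ → Q →L[ℝ] ℝ)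
    (hf : IntervalIntegrable f volume 0 T) (hg : IntervalIntegrable g volume 0 T) :
    ∃ (uh : ℝ → W) (ph : ℝ → P),
      IntervalIntegrable uh volume 0 T ∧ IntervalIntegrable ph volume 0 T ∧
      ∀ᵐ t ∂volume, t ∈ Set.Icc (0:ℝ) T →
        (∀ v : W, a (iV (uh t)) (iV v) + b (iV v) (iQ (ph t)) = f t (iV v) +
          ∫ s in (0:ℝ)..t, (k₁ t s * a (iV (uh s)) (iV v) + k₂ t s * b (iV v) (iQ (ph s)))) ∧
        (∀ v : P, b (iV (uh t)) (iQ v) - c (iQ (ph t)) (iQ v) = g t (iQ v) +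
          ∫ s in (0:ℝ)..t, (k₃ t s * b (iV (uh s)) (iQ v) - k₄ t s * c (iQ (ph s)) (iQ v))) := by
  let rV : (V →L[ℝ] ℝ) →L[ℝ] (W →L[ℝ] ℝ) := ContinuousLinearMap.precomp ℝ iV
  let rQ : (Q →L[ℝ] ℝ) →L[ℝ] (P →L[ℝ] ℝ) := ContinuousLinearMap.precomp ℝ iQ
  let P1 : (W × P) →L[ℝ] V := iV ∘L ContinuousLinearMap.fst ℝ W P
  let P2 : (W × P) →L[ℝ] Q := iQ ∘L ContinuousLinearMap.snd ℝ W P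
  let K1 : (W × P) →L[ℝ] (W →L[ℝ] ℝ) × (P →L[ℝ] ℝ) := (rV ∘L a ∘L P1).prod 0
  let K2 : (W × P) →L[ℝ] (W →L[ℝ] ℝ) × (P →L[ℝ] ℝ) := (rV ∘L b.flip ∘L P2).prod 0
  let K3 : (W × P) →L[ℝ] (W →L[ℝ] ℝ) × (P →L[ℝ] ℝ) :=
    ContinuousLinearMap.prod 0 (rQ ∘L b ∘L P1)
  let K4 : (W × P) →L[ℝ] (W →L[ℝ] ℝ) × (P →L[ℝ] ℝ) :=
    ContinuousLinearMap.prod 0 (-(rQ ∘L c ∘L P2))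
  let L := K1 + K2 + K3 + K4
  have K1v : ∀ x v, (K1 x).1 v = a (iV x.1) (iV v) := fun x v => rfl
  have K2v : ∀ x v, (K2 x).1 v = b (iV v) (iQ x.2) := fun x v => rfl
  have K3v : ∀ x v, (K3 x).1 v = 0 := fun x v => rfl
  have K4v : ∀ x v, (K4 x).1 v = 0 := fun x v => rfl
  have K1q : ∀ x v, (K1 x).2 v = 0 := fun x v => rfl
  have K2q : ∀ x v, (K2 x).2 v = 0 := fun x v => rfl
  have K3q : ∀ x v, (K3 x).2 v = b (iV x.1) (iQ v) := fun x v => rfl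
  have K4q : ∀ x v, (K4 x).2 v = - c (iQ x.2) (iQ v) := fun x v => rfl
  have Lv : ∀ x v, (L x).1 v = a (iV x.1) (iV v) + b (iV v) (iQ x.2) := by
    intro x v
    have : (L x).1 v = (K1 x).1 v + (K2 x).1 v + (K3 x).1 v + (K4 x).1 v := rfl
    rw [this, K1v, K2v, K3v, K4v]; ring
  have Lq : ∀ x v, (L x).2 v = b (iV x.1) (iQ v) - c (iQ x.2) (iQ v) := by
    intro x v
    have : (L x).2 v = (K1 x).2 v + (K2 x).2 v + (K3 x).2 v + (K4 x).2 v := rfl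
    rw [this, K1q, K2q, K3q, K4q]; ring
  clear_value K1 K2 K3 K4
  clear_value L
  have Linj : Function.Injective L := by
    rw [injective_iff_map_eq_zero]
    intro x hx
    have := hst x.1 x.2 (fun w => by rw [← Lv x w, hx]; simp) (fun w => by rw [← Lq x w, hx]; simp)
    exact Prod.ext this.1 this.2
  have hfr : Module.finrank ℝ (W × P) =
      Module.finrank ℝ ((W →L[ℝ] ℝ) × (P →L[ℝ] ℝ)) := by
    rw [Module.finrank_prod, Module.finrank_prod,
      ← (LinearMap.toContinuousLinearMap : (W →ₗ[ℝ] ℝ) ≃ₗ[ℝ] (W →L[ℝ] ℝ)).finrank_eq,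
      ← (LinearMap.toContinuousLinearMap : (P →ₗ[ℝ] ℝ) ≃ₗ[ℝ] (P →L[ℝ] ℝ)).finrank_eq]
    have e1 : Module.finrank ℝ (W →ₗ[ℝ] ℝ) = Module.finrank ℝ W := Subspace.dual_finrank_eq
    have e2 : Module.finrank ℝ (P →ₗ[ℝ] ℝ) = Module.finrank ℝ P := Subspace.dual_finrank_eq
    rw [e1, e2]
  have Lsurj : Function.Surjective L.toLinearMap :=
    (LinearMap.injective_iff_surjective_of_finrank_eq_finrank hfr).1 Linj
  obtain ⟨Li0, hLi0⟩ := L.toLinearMap.exists_rightInverse_of_surjective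
    (LinearMap.range_eq_top.2 Lsurj)
  let Li : (W →L[ℝ] ℝ) × (P →L[ℝ] ℝ) →L[ℝ] (W × P) := LinearMap.toContinuousLinearMap Li0
  have hLi : ∀ y, L (Li y) = y := fun y => LinearMap.congr_fun hLi0 y
  clear_value Li
  have i1 : Integrable (fun t => rV (f t)) (volume.restrict (Set.Ioc 0 T)) :=
    aux_comp_int rV hf.1
  have i2 : Integrable (fun t => rQ (g t)) (volume.restrict (Set.Ioc 0 T)) :=
    aux_comp_int rQ hg.1
  obtain ⟨x, hxi, hx⟩ := aux_volterra2 Ck1 Ck2 Ck3 Ck4 T hT hCk1 hCk2 hCk3 hCk4 k₁ k₂ k₃ k₄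
    hm1 hm2 hm3 hm4 K1 K2 K3 K4 L Li hLi (fun t => (rV (f t), rQ (g t)))
    (i1.prodMk i2)
  have hne : ∀ᵐ t : ℝ, t ≠ 0 := by
    rw [ae_iff]; simp
  refine ⟨fun t => (x t).1, fun t => (x t).2,
    ⟨aux_comp_int (ContinuousLinearMap.fst ℝ W P) hxi.1,
      aux_comp_int (ContinuousLinearMap.fst ℝ W P) hxi.2⟩,
    ⟨aux_comp_int (ContinuousLinearMap.snd ℝ W P) hxi.1,
      aux_comp_int (ContinuousLinearMap.snd ℝ W P) hxi.2⟩, ?_⟩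
  filter_upwards [hx, hne, aux_ker_ae T Ck1 k₁ h1, aux_ker_ae T Ck2 k₂ h2,
    aux_ker_ae T Ck3 k₃ h3, aux_ker_ae T Ck4 k₄ h4] with t hψ ht0 r1 r2 r3 r4 ht
  have htI : t ∈ Set.Ioc 0 T := ⟨lt_of_le_of_ne ht.1 (Ne.symm ht0), ht.2⟩
  constructor
  · intro v
    have e' : (L (x t)).1 v = f t (iV v) +
        ∫ s, (auxK T Ck1 k₁ t s * (K1 (x s)).1 v +
        auxK T Ck2 k₂ t s * (K2 (x s)).1 v +
        auxK T Ck3 k₃ t s * (K3 (x s)).1 v +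
        auxK T Ck4 k₄ t s * (K4 (x s)).1 v) :=
      hψ htI ((ContinuousLinearMap.apply ℝ ℝ v) ∘L (ContinuousLinearMap.fst ℝ _ _))
    have e2 : ∀ s, auxK T Ck1 k₁ t s * (K1 (x s)).1 v +
        auxK T Ck2 k₂ t s * (K2 (x s)).1 v +
        auxK T Ck3 k₃ t s * (K3 (x s)).1 v +
        auxK T Ck4 k₄ t s * (K4 (x s)).1 v =
        auxK T Ck1 k₁ t s * a (iV (x s).1) (iV v) + auxK T Ck2 k₂ t s * b (iV v) (iQ (x s).2) := by
      intro s
      rw [K1v, K2v, K3v, K4v]; ring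
    simp_rw [e2] at e'
    rw [Lv, auxK_int T Ck1 Ck2 k₁ k₂ t ht (r1 ht) (r2 ht)] at e'
    exact e'
  · intro v
    have e' : (L (x t)).2 v = g t (iQ v) +
        ∫ s, (auxK T Ck1 k₁ t s * (K1 (x s)).2 v +
        auxK T Ck2 k₂ t s * (K2 (x s)).2 v +
        auxK T Ck3 k₃ t s * (K3 (x s)).2 v +
        auxK T Ck4 k₄ t s * (K4 (x s)).2 v) :=
      hψ htI ((ContinuousLinearMap.apply ℝ ℝ v) ∘L (ContinuousLinearMap.snd ℝ _ _))
    have e2 : ∀ s, auxK T Ck1 k₁ t s * (K1 (x s)).2 v +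
        auxK T Ck2 k₂ t s * (K2 (x s)).2 v +
        auxK T Ck3 k₃ t s * (K3 (x s)).2 v +
        auxK T Ck4 k₄ t s * (K4 (x s)).2 v =
        auxK T Ck3 k₃ t s * b (iV (x s).1) (iQ v) + auxK T Ck4 k₄ t s * (- c (iQ (x s).2) (iQ v)) := by
      intro s
      rw [K1q, K2q, K3q, K4q]; ring
    simp_rw [e2] at e'
    rw [Lq, auxK_int T Ck3 Ck4 k₃ k₄ t ht (r3 ht) (r4 ht)] at e'
    simp only [mul_neg, ← sub_eq_add_neg] at e'
    exact e'

lemma aux_exist {V Q : Type} [NormedAddCommGroup V] [InnerProductSpace ℝ V]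
    [NormedAddCommGroup Q] [InnerProductSpace ℝ Q]
    (M Ck1 Ck2 Ck3 Ck4 T : ℝ) (hT : 0 < T)
    (hCk1 : 0 ≤ Ck1) (hCk2 : 0 ≤ Ck2) (hCk3 : 0 ≤ Ck3) (hCk4 : 0 ≤ Ck4)
    (a : V →L[ℝ] V →L[ℝ] ℝ) (b : V →L[ℝ] Q →L[ℝ] ℝ) (c : Q →L[ℝ] Q →L[ℝ] ℝ)
    (k₁ k₂ k₃ k₄ : ℝ → ℝ → ℝ)
    (hm1 : Measurable (Function.uncurry k₁)) (hm2 : Measurable (Function.uncurry k₂))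
    (hm3 : Measurable (Function.uncurry k₃)) (hm4 : Measurable (Function.uncurry k₄))
    (h1 : ∀ᵐ ts : ℝ × ℝ ∂volume,
      0 ≤ ts.2 → ts.2 ≤ ts.1 → ts.1 ≤ T → |k₁ ts.1 ts.2| ≤ Ck1)
    (h2 : ∀ᵐ ts : ℝ × ℝ ∂volume,
      0 ≤ ts.2 → ts.2 ≤ ts.1 → ts.1 ≤ T → |k₂ ts.1 ts.2| ≤ Ck2)
    (h3 : ∀ᵐ ts : ℝ × ℝ ∂volume,
      0 ≤ ts.2 → ts.2 ≤ ts.1 → ts.1 ≤ T → |k₃ ts.1 ts.2| ≤ Ck3)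
    (h4 : ∀ᵐ ts : ℝ × ℝ ∂volume,
      0 ≤ ts.2 → ts.2 ≤ ts.1 → ts.1 ≤ T → |k₄ ts.1 ts.2| ≤ Ck4)
    (Vh : Submodule ℝ V) (Qh : Submodule ℝ Q)
    [FiniteDimensional ℝ Vh] [FiniteDimensional ℝ Qh]
    (hst : ∀ u ∈ Vh, ∀ p ∈ Qh, ∀ D : ℝ, 0 ≤ D →
          (∀ v ∈ Vh, |a u v + b v p| ≤ D * ‖v‖) → (∀ q ∈ Qh, |b u q - c p q| ≤ D * ‖q‖) →
          ‖u‖ + ‖p‖ ≤ M * D)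
    (f : ℝ → V →L[ℝ] ℝ) (g : ℝ → Q →L[ℝ] ℝ)
    (hf : IntervalIntegrable f volume 0 T) (hg : IntervalIntegrable g volume 0 T) :
    ∃ (uh : ℝ → V) (ph : ℝ → Q),
          (∀ t : ℝ, uh t ∈ Vh) ∧ (∀ t : ℝ, ph t ∈ Qh) ∧
          IntervalIntegrable uh volume 0 T ∧ IntervalIntegrable ph volume 0 T ∧
          SolvesPOn V Q T a b c k₁ k₂ k₃ k₄ f g Vh Qh uh ph := by
  obtain ⟨uh, ph, i1, i2, h⟩ := aux_exist0 Vh.subtypeL Qh.subtypeL Ck1 Ck2 Ck3 Ck4 T hT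
    hCk1 hCk2 hCk3 hCk4 a b c k₁ k₂ k₃ k₄ hm1 hm2 hm3 hm4 h1 h2 h3 h4 (by
      intro w p e1 e2
      have := hst w w.2 p p.2 0 le_rfl
        (fun v hv => by
          have := e1 ⟨v, hv⟩
          simp only [Submodule.subtypeL_apply] at this
          rw [this]; simp)
        (fun v hv => by
          have := e2 ⟨v, hv⟩
          simp only [Submodule.subtypeL_apply] at this
          rw [this]; simp)
      rw [mul_zero] at this
      have n1 := norm_nonneg (w : V)
      have n2 := norm_nonneg (p : Q)
      have z1 : ‖(w : V)‖ = 0 := by linarith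
      have z2 : ‖(p : Q)‖ = 0 := by linarith
      exact ⟨Subtype.ext (norm_eq_zero.1 z1), Subtype.ext (norm_eq_zero.1 z2)⟩) f g hf hg
  refine ⟨fun t => uh t, fun t => ph t, fun t => (uh t).2, fun t => (ph t).2,
    ⟨aux_comp_int Vh.subtypeL i1.1, aux_comp_int Vh.subtypeL i1.2⟩,
    ⟨aux_comp_int Qh.subtypeL i2.1, aux_comp_int Qh.subtypeL i2.2⟩, ?_⟩
  unfold SolvesPOn
  filter_upwards [h] with t h ht
  exact ⟨fun v hv => (h ht).1 ⟨v, hv⟩, fun q hq => (h ht).2 ⟨q, hq⟩⟩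

/-- Under the setup, the semi-discrete assumptions and the discrete
inf-sup condition with constant `β* > 0`, the semi-discrete Problem (P_h) has a unique
solution `(u_h,p_h)` (up to a.e. equality), and there is a constant `C > 0`, depending
only on `α₀*, β*, γ₀*, ‖a‖, ‖b‖, ‖c‖, C_{k₁},…,C_{k₄}, T`, such that for every solution
`(u,p)` of Problem (P),
`‖u_h − u‖₁ + ‖p_h − p‖₁ ≤ C (inf_{v ∈ L¹(J;V_h)} ‖u − v‖₁ + inf_{q ∈ L¹(J;Q_h)} ‖p − q‖₁)`. -/
theorem statement14
    (α₀s βs γ₀s Na Nb Nc Ck1 Ck2 Ck3 Ck4 T : ℝ)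
    (hα₀s : 0 < α₀s) (hβs : 0 < βs) (hγ₀s : 0 < γ₀s) (hT : 0 < T)
    (hNa : 0 ≤ Na) (hNb : 0 ≤ Nb) (hNc : 0 ≤ Nc)
    (hCk1 : 0 ≤ Ck1) (hCk2 : 0 ≤ Ck2) (hCk3 : 0 ≤ Ck3) (hCk4 : 0 ≤ Ck4) :
    ∃ C : ℝ, 0 < C ∧
      ∀ (V Q : Type)
        [NormedAddCommGroup V] [InnerProductSpace ℝ V] [CompleteSpace V]
        [NormedAddCommGroup Q] [InnerProductSpace ℝ Q] [CompleteSpace Q]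
        (a : V →L[ℝ] V →L[ℝ] ℝ) (b : V →L[ℝ] Q →L[ℝ] ℝ) (c : Q →L[ℝ] Q →L[ℝ] ℝ)
        (k₁ k₂ k₃ k₄ : ℝ → ℝ → ℝ),
        (∀ v w : V, a v w = a w v) → (∀ v : V, 0 ≤ a v v) →
        (∀ q r : Q, c q r = c r q) → (∀ q : Q, 0 ≤ c q q) →
        ‖a‖ ≤ Na → ‖b‖ ≤ Nb → ‖c‖ ≤ Nc →
        Measurable (Function.uncurry k₁) → Measurable (Function.uncurry k₂) →
        Measurable (Function.uncurry k₃) → Measurable (Function.uncurry k₄) →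
        (∀ᵐ ts : ℝ × ℝ ∂volume,
          0 ≤ ts.2 → ts.2 ≤ ts.1 → ts.1 ≤ T → |k₁ ts.1 ts.2| ≤ Ck1) →
        (∀ᵐ ts : ℝ × ℝ ∂volume,
          0 ≤ ts.2 → ts.2 ≤ ts.1 → ts.1 ≤ T → |k₂ ts.1 ts.2| ≤ Ck2) →
        (∀ᵐ ts : ℝ × ℝ ∂volume,
          0 ≤ ts.2 → ts.2 ≤ ts.1 → ts.1 ≤ T → |k₃ ts.1 ts.2| ≤ Ck3) →
        (∀ᵐ ts : ℝ × ℝ ∂volume,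
          0 ≤ ts.2 → ts.2 ≤ ts.1 → ts.1 ≤ T → |k₄ ts.1 ts.2| ≤ Ck4) →
        ∀ (Vh : Submodule ℝ V) (Qh : Submodule ℝ Q),
        FiniteDimensional ℝ Vh → FiniteDimensional ℝ Qh →
        -- ellipticity on the discrete kernels
        (∀ v ∈ discKh V Q b Vh Qh, α₀s * ‖v‖ ^ 2 ≤ a v v) →
        (∀ q ∈ discHh V Q b Vh Qh, γ₀s * ‖q‖ ^ 2 ≤ c q q) →
        -- discrete inf-sup conditions
        (∀ q : Q, q ∈ Qh → q ∈ (discHh V Q b Vh Qh)ᗮ →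
          ∃ v ∈ Vh, ‖v‖ ≤ 1 ∧ βs * ‖q‖ ≤ b v q) →
        (∀ v : V, v ∈ Vh → v ∈ (discKh V Q b Vh Qh)ᗮ →
          ∃ q ∈ Qh, ‖q‖ ≤ 1 ∧ βs * ‖v‖ ≤ b v q) →
        ∀ (f : ℝ → V →L[ℝ] ℝ) (g : ℝ → Q →L[ℝ] ℝ),
        IntervalIntegrable f volume 0 T → IntervalIntegrable g volume 0 T →
        ∃ (uh : ℝ → V) (ph : ℝ → Q),
          (∀ t : ℝ, uh t ∈ Vh) ∧ (∀ t : ℝ, ph t ∈ Qh) ∧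
          IntervalIntegrable uh volume 0 T ∧ IntervalIntegrable ph volume 0 T ∧
          SolvesPOn V Q T a b c k₁ k₂ k₃ k₄ f g Vh Qh uh ph ∧
          -- uniqueness (up to a.e. equality) of the semi-discrete solution
          (∀ (uh' : ℝ → V) (ph' : ℝ → Q),
            (∀ t : ℝ, uh' t ∈ Vh) → (∀ t : ℝ, ph' t ∈ Qh) →
            IntervalIntegrable uh' volume 0 T → IntervalIntegrable ph' volume 0 T →
            SolvesPOn V Q T a b c k₁ k₂ k₃ k₄ f g Vh Qh uh' ph' →
            ∀ᵐ t ∂volume, t ∈ Set.Icc (0:ℝ) T → uh' t = uh t ∧ ph' t = ph t) ∧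
          -- quasi-optimal error estimate against any solution of Problem (P)
          (∀ (u : ℝ → V) (p : ℝ → Q),
            IntervalIntegrable u volume 0 T → IntervalIntegrable p volume 0 T →
            SolvesPOn V Q T a b c k₁ k₂ k₃ k₄ f g ⊤ ⊤ u p →
            ∀ (v : ℝ → V) (q : ℝ → Q),
              (∀ t : ℝ, v t ∈ Vh) → (∀ t : ℝ, q t ∈ Qh) →
              IntervalIntegrable v volume 0 T → IntervalIntegrable q volume 0 T →
              (∫ t in (0:ℝ)..T, ‖uh t - u t‖) + (∫ t in (0:ℝ)..T, ‖ph t - p t‖)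
                ≤ C * ((∫ t in (0:ℝ)..T, ‖u t - v t‖)
                    + ∫ t in (0:ℝ)..T, ‖p t - q t‖)) := by
  obtain ⟨M, hM, Hst⟩ := aux_stab α₀s βs γ₀s Na Nc hα₀s hβs hγ₀s hNa hNc
  refine ⟨Real.exp (M * ((Ck1 + Ck2 + Ck3 + Ck4) * (Na + Nb + Nc)) * T) *
    (1 + M * (Na + Nb + Nc)), by positivity, ?_⟩
  intro V Q _ _ _ _ _ _ a b c k₁ k₂ k₃ k₄ has hap hcs hcp ha hb hc hm1 hm2 hm3 hm4 h1 h2 h3 h4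
    Vh Qh _ _ hK hH hib hiv f g hf hg
  have hst := Hst V Q a b c has hap hcs hcp ha hc Vh Qh inferInstance inferInstance hK hH hib hiv
  obtain ⟨uh, ph, huh, hph, iuh, iph, S⟩ := aux_exist M Ck1 Ck2 Ck3 Ck4 T hT hCk1 hCk2 hCk3 hCk4
    a b c k₁ k₂ k₃ k₄ hm1 hm2 hm3 hm4 h1 h2 h3 h4 Vh Qh hst f g hf hg
  refine ⟨uh, ph, huh, hph, iuh, iph, S, ?_, ?_⟩
  · intro uh' ph' huh' hph' iuh' iph' S'
    have he := aux_error M Na Nb Nc Ck1 Ck2 Ck3 Ck4 T hM hT hNa hNb hNc hCk1 hCk2 hCk3 hCk4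
      a b c k₁ k₂ k₃ k₄ ha hb hc hm1 hm2 hm3 hm4 h1 h2 h3 h4 Vh Qh hst f g uh' uh uh ph' ph ph
      huh' hph' huh hph iuh' iph' iuh iph iuh iph S' S
    simp only [sub_self, norm_zero, intervalIntegral.integral_zero, add_zero, mul_zero] at he
    have j1 := (iuh'.sub iuh).norm
    have j2 := (iph'.sub iph).norm
    have n1 : 0 ≤ ∫ t in (0:ℝ)..T, ‖uh' t - uh t‖ :=
      intervalIntegral.integral_nonneg hT.le (fun _ _ => norm_nonneg _)
    have n2 : 0 ≤ ∫ t in (0:ℝ)..T, ‖ph' t - ph t‖ :=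
      intervalIntegral.integral_nonneg hT.le (fun _ _ => norm_nonneg _)
    have z1 : ∫ t in (0:ℝ)..T, ‖uh' t - uh t‖ = 0 := by linarith
    have z2 : ∫ t in (0:ℝ)..T, ‖ph' t - ph t‖ = 0 := by linarith
    rw [intervalIntegral.integral_eq_zero_iff_of_le_of_nonneg_ae hT.le
      (Filter.Eventually.of_forall fun _ => norm_nonneg _) j1, Filter.EventuallyEq,
      ae_restrict_iff' measurableSet_Ioc] at z1
    rw [intervalIntegral.integral_eq_zero_iff_of_le_of_nonneg_ae hT.le
      (Filter.Eventually.of_forall fun _ => norm_nonneg _) j2, Filter.EventuallyEq,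
      ae_restrict_iff' measurableSet_Ioc] at z2
    have hne : ∀ᵐ t : ℝ, t ≠ 0 := by
      rw [ae_iff]; simp
    filter_upwards [z1, z2, hne] with t w1 w2 ht0 ht
    have htI : t ∈ Set.Ioc 0 T := ⟨lt_of_le_of_ne ht.1 (Ne.symm ht0), ht.2⟩
    exact ⟨sub_eq_zero.1 (norm_eq_zero.1 (w1 htI)), sub_eq_zero.1 (norm_eq_zero.1 (w2 htI))⟩
  · intro u p iu ip SP v q hv hq iv iq
    refine aux_error M Na Nb Nc Ck1 Ck2 Ck3 Ck4 T hM hT hNa hNb hNc hCk1 hCk2 hCk3 hCk4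
      a b c k₁ k₂ k₃ k₄ ha hb hc hm1 hm2 hm3 hm4 h1 h2 h3 h4 Vh Qh hst f g uh u v ph p q
      huh hph hv hq iuh iph iu ip iv iq S ?_
    filter_upwards [SP] with t h ht
    exact ⟨fun w _ => (h ht).1 w trivial, fun w _ => (h ht).2 w trivial⟩
end

section
/- Under the λ-setup and semi-discrete assumptions, suppose the semi-discrete stability bounds hold with constants C₁, C₂, C₃, C₄ > 0: whenever (ξ_u,ξ_p) ∈ L¹(J;V_h) × L¹(J;Q_h) satisfies, for a.e. t and all (v,q) ∈ V_h × Q_h, a(ξ_u(t),v) + b(v,ξ_p(t)) = ⟨F(t),v⟩ + ∫₀ᵗ [k₁(t,s) a(ξ_u(s),v) + k₂(t,s) b(v,ξ_p(s))] ds and b(ξ_u(t),q) − λ(ξ_p(t),q)_Q = ⟨G(t),q⟩ with F ∈ L¹(J;V'), G ∈ L¹(J;Q'), then ‖ξ_u‖_{L¹(J;V)} ≤ C₁‖F‖_{L¹(J;V')} + C₂‖G‖_{L¹(J;Q')} and ‖ξ_p‖_{L¹(J;Q)} ≤ C₃‖F‖ + C₄‖G‖. Let (u,p) solve Problem (P_λ)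 and (u_h,p_h) solve the semi-discrete Problem (P_{λ,h}). Then for every u_I ∈ L¹(J;V_h) and p_I ∈ L¹(J;Q_h), with C_k := max{C_{k₁}, C_{k₂}}: ‖u_h − u‖_{L¹(J;V)} ≤ C_{1u}‖u − u_I‖_{L¹(J;V)} + C_{1p}‖p − p_I‖_{L¹(J;Q)} and ‖p_h − p‖_{L¹(J;Q)} ≤ C_{2u}‖u − u_I‖_{L¹(J;V)} + C_{2p}‖p − p_I‖_{L¹(J;Q)}, where C_{1u} = C₁‖a‖(1+TC_k) + C₂‖b‖ + 1, C_{1p} = C₁‖b‖(1+TC_k) + C₂λ, C_{2u} = C₃‖a‖(1+TC_k) + C₄‖b‖, C_{2p} = C₃‖b‖(1+TC_k) + C₄λ + 1. -/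
open MeasureTheory
open scoped RealInnerProductSpace

theorem aux_volterra_s16 {E : Type*} [NormedAddCommGroup E] [NormedSpace ℝ E]
    (T : ℝ) (hT : 0 < T) (k : ℝ → ℝ → ℝ) (C : ℝ) (hC : 0 ≤ C)
    (hk : Measurable (Function.uncurry k))
    (hb : ∀ᵐ ts : ℝ × ℝ ∂volume,
      0 ≤ ts.2 → ts.2 ≤ ts.1 → ts.1 ≤ T → |k ts.1 ts.2| ≤ C)
    (w : ℝ → E) (hw : IntervalIntegrable w volume 0 T) :
    (∀ᵐ t ∂volume, t ∈ Set.Icc (0:ℝ) T →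
      IntervalIntegrable (fun s => k t s • w s) volume 0 t) ∧
    (∀ᵐ t ∂volume, t ∈ Set.Icc (0:ℝ) T →
      ‖∫ s in (0:ℝ)..t, k t s • w s‖ ≤ C * ∫ s in (0:ℝ)..T, ‖w s‖) ∧
    IntervalIntegrable (fun t => ∫ s in (0:ℝ)..t, k t s • w s) volume 0 T := by
  have hb' : ∀ᵐ t : ℝ ∂volume, ∀ᵐ s : ℝ ∂volume,
      0 ≤ s → s ≤ t → t ≤ T → |k t s| ≤ C := Measure.ae_ae_of_ae_prod hb
  have hsub : ∀ t ∈ Set.Icc (0:ℝ) T, IntervalIntegrable w volume 0 t := by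
    intro t ht
    apply hw.mono_set
    rw [Set.uIcc_of_le ht.1, Set.uIcc_of_le hT.le]
    exact Set.Icc_subset_Icc_right ht.2
  have h1 : ∀ᵐ t ∂volume, t ∈ Set.Icc (0:ℝ) T →
      IntervalIntegrable (fun s => k t s • w s) volume 0 t := by
    filter_upwards [hb'] with t h ht
    have hwt := hsub t ht
    refine (hwt.norm.const_mul C).mono_fun ?_ ?_
    · exact ((hk.comp measurable_prodMk_left).aestronglyMeasurable).smul
        (by have := hwt.1.aestronglyMeasurable; rwa [Set.uIoc_of_le ht.1])
    · rw [Set.uIoc_of_le ht.1]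
      filter_upwards [ae_restrict_of_ae h, ae_restrict_mem measurableSet_Ioc] with s hs hm
      have := hs hm.1.le hm.2 ht.2
      rw [norm_smul, norm_mul, norm_norm, Real.norm_eq_abs, Real.norm_eq_abs, abs_of_nonneg hC]
      gcongr
  have h2 : ∀ᵐ t ∂volume, t ∈ Set.Icc (0:ℝ) T →
      ‖∫ s in (0:ℝ)..t, k t s • w s‖ ≤ C * ∫ s in (0:ℝ)..T, ‖w s‖ := by
    filter_upwards [hb'] with t h ht
    have hwt := hsub t ht
    calc ‖∫ s in (0:ℝ)..t, k t s • w s‖ ≤ ∫ s in (0:ℝ)..t, C * ‖w s‖ := by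
          refine intervalIntegral.norm_integral_le_of_norm_le ht.1 ?_ (hwt.norm.const_mul C)
          filter_upwards [h] with s hs hm
          have := hs hm.1.le hm.2 ht.2
          rw [norm_smul, Real.norm_eq_abs]
          gcongr
      _ = C * ∫ s in (0:ℝ)..t, ‖w s‖ := intervalIntegral.integral_const_mul _ _
      _ ≤ _ := by
          gcongr
          exact intervalIntegral.integral_mono_interval le_rfl ht.1 ht.2
            (Filter.Eventually.of_forall fun s => norm_nonneg _) hw.norm
  refine ⟨h1, h2, ?_⟩
  set μ := (volume : Measure ℝ).restrict (Set.Ioc 0 T) with hμ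
  have hwm : AEStronglyMeasurable w μ := hw.1.aestronglyMeasurable
  have hm : AEStronglyMeasurable (fun t => ∫ s in (0:ℝ)..t, k t s • w s) μ := by
    have hK : AEStronglyMeasurable
        (({z : ℝ × ℝ | z.2 ≤ z.1}).indicator (fun z : ℝ × ℝ => k z.1 z.2 • w z.2)) (μ.prod μ) := by
      refine AEStronglyMeasurable.indicator ?_ (measurableSet_le measurable_snd measurable_fst)
      exact (hk.aestronglyMeasurable).smul hwm.comp_snd
    refine hK.integral_prod_right'.congr ?_
    filter_upwards [ae_restrict_mem measurableSet_Ioc] with t ht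
    rw [intervalIntegral.integral_of_le ht.1.le]
    have : ∀ s, ({z : ℝ × ℝ | z.2 ≤ z.1}).indicator (fun z : ℝ × ℝ => k z.1 z.2 • w z.2) (t, s)
        = (Set.Iic t).indicator (fun s => k t s • w s) s := by
      intro s
      simp [Set.indicator]
    simp_rw [this]
    rw [integral_indicator measurableSet_Iic, hμ, Measure.restrict_restrict measurableSet_Iic]
    congr 2
    ext s
    simp only [Set.mem_inter_iff, Set.mem_Iic, Set.mem_Ioc]
    constructor
    · rintro ⟨h, h', _⟩; exact ⟨h', h⟩
    · rintro ⟨h, h'⟩; exact ⟨h', h, h'.trans ht.2⟩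
  rw [intervalIntegrable_iff_integrableOn_Ioc_of_le hT.le]
  refine Integrable.of_bound hm (C * ∫ s in (0:ℝ)..T, ‖w s‖) ?_
  filter_upwards [ae_restrict_of_ae h2, ae_restrict_mem measurableSet_Ioc] with t h ht
  exact h ⟨ht.1.le, ht.2⟩

/-- Under the λ-setup and semi-discrete assumptions, given the
semi-discrete stability bounds with constants `C₁, C₂, C₃, C₄ > 0`, if `(u,p)` solves
Problem (P_λ) and `(u_h,p_h)` solves Problem (P_{λ,h}), then for every
`u_I ∈ L¹(J;V_h)` and `p_I ∈ L¹(J;Q_h)`, with `C_k = max{C_{k₁}, C_{k₂}}`: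
`‖u_h − u‖₁ ≤ C_{1u}‖u − u_I‖₁ + C_{1p}‖p − p_I‖₁` and
`‖p_h − p‖₁ ≤ C_{2u}‖u − u_I‖₁ + C_{2p}‖p − p_I‖₁`, with the explicit constants
`C_{1u} = C₁‖a‖(1+TC_k) + C₂‖b‖ + 1`, `C_{1p} = C₁‖b‖(1+TC_k) + C₂λ`,
`C_{2u} = C₃‖a‖(1+TC_k) + C₄‖b‖`, `C_{2p} = C₃‖b‖(1+TC_k) + C₄λ + 1`. -/
theorem statement16
    {V Q : Type*} [NormedAddCommGroup V] [InnerProductSpace ℝ V] [CompleteSpace V]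
    [NormedAddCommGroup Q] [InnerProductSpace ℝ Q] [CompleteSpace Q]
    (T lam : ℝ) (hT : 0 < T) (hlam : 0 < lam)
    (a : V →L[ℝ] V →L[ℝ] ℝ) (b : V →L[ℝ] Q →L[ℝ] ℝ)
    (ha_symm : ∀ v w : V, a v w = a w v) (ha_pos : ∀ v : V, 0 ≤ a v v)
    (k₁ k₂ : ℝ → ℝ → ℝ) (Ck1 Ck2 : ℝ) (hCk1 : 0 ≤ Ck1) (hCk2 : 0 ≤ Ck2)
    (hk₁_meas : Measurable (Function.uncurry k₁))
    (hk₂_meas : Measurable (Function.uncurry k₂))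
    (hk₁_bdd : ∀ᵐ ts : ℝ × ℝ ∂volume,
      0 ≤ ts.2 → ts.2 ≤ ts.1 → ts.1 ≤ T → |k₁ ts.1 ts.2| ≤ Ck1)
    (hk₂_bdd : ∀ᵐ ts : ℝ × ℝ ∂volume,
      0 ≤ ts.2 → ts.2 ≤ ts.1 → ts.1 ≤ T → |k₂ ts.1 ts.2| ≤ Ck2)
    (Vh : Submodule ℝ V) (Qh : Submodule ℝ Q)
    (hVh : FiniteDimensional ℝ Vh) (hQh : FiniteDimensional ℝ Qh)
    (C₁ C₂ C₃ C₄ : ℝ) (hC₁ : 0 < C₁) (hC₂ : 0 < C₂) (hC₃ : 0 < C₃) (hC₄ : 0 < C₄)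
    -- the semi-discrete stability bounds
    (hstab : ∀ (F : ℝ → V →L[ℝ] ℝ) (G : ℝ → Q →L[ℝ] ℝ) (ξu : ℝ → V) (ξp : ℝ → Q),
      IntervalIntegrable F volume 0 T → IntervalIntegrable G volume 0 T →
      IntervalIntegrable ξu volume 0 T → IntervalIntegrable ξp volume 0 T →
      (∀ t : ℝ, ξu t ∈ Vh) → (∀ t : ℝ, ξp t ∈ Qh) →
      (∀ᵐ t ∂volume, t ∈ Set.Icc (0:ℝ) T →
        (∀ v ∈ Vh, a (ξu t) v + b v (ξp t)
            = F t v + ∫ s in (0:ℝ)..t, (k₁ t s * a (ξu s) v + k₂ t s * b v (ξp s))) ∧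
        (∀ q ∈ Qh, b (ξu t) q - lam * ⟪ξp t, q⟫ = G t q)) →
      (∫ t in (0:ℝ)..T, ‖ξu t‖)
          ≤ C₁ * (∫ t in (0:ℝ)..T, ‖F t‖) + C₂ * (∫ t in (0:ℝ)..T, ‖G t‖) ∧
      (∫ t in (0:ℝ)..T, ‖ξp t‖)
          ≤ C₃ * (∫ t in (0:ℝ)..T, ‖F t‖) + C₄ * (∫ t in (0:ℝ)..T, ‖G t‖))
    (f : ℝ → V →L[ℝ] ℝ) (g : ℝ → Q →L[ℝ] ℝ)
    (hf : IntervalIntegrable f volume 0 T) (hg : IntervalIntegrable g volume 0 T)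
    -- (u,p) solves Problem (P_λ)
    (u : ℝ → V) (p : ℝ → Q)
    (hu : IntervalIntegrable u volume 0 T) (hp : IntervalIntegrable p volume 0 T)
    (hsol : ∀ᵐ t ∂volume, t ∈ Set.Icc (0:ℝ) T →
      (∀ v : V, a (u t) v + b v (p t)
          = f t v + ∫ s in (0:ℝ)..t, (k₁ t s * a (u s) v + k₂ t s * b v (p s))) ∧
      (∀ q : Q, b (u t) q - lam * ⟪p t, q⟫ = g t q))
    -- (u_h,p_h) solves the semi-discrete Problem (P_{λ,h})
    (uh : ℝ → V) (ph : ℝ → Q)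
    (huh : IntervalIntegrable uh volume 0 T) (hph : IntervalIntegrable ph volume 0 T)
    (huh_mem : ∀ t : ℝ, uh t ∈ Vh) (hph_mem : ∀ t : ℝ, ph t ∈ Qh)
    (hsolh : ∀ᵐ t ∂volume, t ∈ Set.Icc (0:ℝ) T →
      (∀ v ∈ Vh, a (uh t) v + b v (ph t)
          = f t v + ∫ s in (0:ℝ)..t, (k₁ t s * a (uh s) v + k₂ t s * b v (ph s))) ∧
      (∀ q ∈ Qh, b (uh t) q - lam * ⟪ph t, q⟫ = g t q)) :
    ∀ (uI : ℝ → V) (pI : ℝ → Q),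
      (∀ t : ℝ, uI t ∈ Vh) → (∀ t : ℝ, pI t ∈ Qh) →
      IntervalIntegrable uI volume 0 T → IntervalIntegrable pI volume 0 T →
      (∫ t in (0:ℝ)..T, ‖uh t - u t‖)
        ≤ (C₁ * ‖a‖ * (1 + T * max Ck1 Ck2) + C₂ * ‖b‖ + 1) *
            (∫ t in (0:ℝ)..T, ‖u t - uI t‖)
          + (C₁ * ‖b‖ * (1 + T * max Ck1 Ck2) + C₂ * lam) *
            (∫ t in (0:ℝ)..T, ‖p t - pI t‖) ∧
      (∫ t in (0:ℝ)..T, ‖ph t - p t‖)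
        ≤ (C₃ * ‖a‖ * (1 + T * max Ck1 Ck2) + C₄ * ‖b‖) *
            (∫ t in (0:ℝ)..T, ‖u t - uI t‖)
          + (C₃ * ‖b‖ * (1 + T * max Ck1 Ck2) + C₄ * lam + 1) *
            (∫ t in (0:ℝ)..T, ‖p t - pI t‖) := by
  intro uI pI huIm hpIm huI hpI
  have hηu := hu.sub huI
  have hηp := hp.sub hpI
  have hξu := huh.sub huI
  have hξp := hph.sub hpI
  obtain ⟨i1, b1, m1⟩ := aux_volterra_s16 T hT k₁ Ck1 hCk1 hk₁_meas hk₁_bdd (fun t => u t - uI t) hηu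
  obtain ⟨i2, b2, m2⟩ := aux_volterra_s16 T hT k₂ Ck2 hCk2 hk₂_meas hk₂_bdd (fun t => p t - pI t) hηp
  obtain ⟨i3, -, -⟩ := aux_volterra_s16 T hT k₁ Ck1 hCk1 hk₁_meas hk₁_bdd u hu
  obtain ⟨i4, -, -⟩ := aux_volterra_s16 T hT k₂ Ck2 hCk2 hk₂_meas hk₂_bdd p hp
  obtain ⟨i5, -, -⟩ := aux_volterra_s16 T hT k₁ Ck1 hCk1 hk₁_meas hk₁_bdd uh huh
  obtain ⟨i6, -, -⟩ := aux_volterra_s16 T hT k₂ Ck2 hCk2 hk₂_meas hk₂_bdd ph hph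
  obtain ⟨i7, -, -⟩ := aux_volterra_s16 T hT k₁ Ck1 hCk1 hk₁_meas hk₁_bdd uI huI
  obtain ⟨i8, -, -⟩ := aux_volterra_s16 T hT k₂ Ck2 hCk2 hk₂_meas hk₂_bdd pI hpI
  -- splitting of the memory term
  have split : ∀ (t : ℝ) (x : ℝ → V) (y : ℝ → Q) (v : V),
      IntervalIntegrable (fun s => k₁ t s • x s) volume 0 t →
      IntervalIntegrable (fun s => k₂ t s • y s) volume 0 t →
      (∫ s in (0:ℝ)..t, (k₁ t s * a (x s) v + k₂ t s * b v (y s)))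
        = a (∫ s in (0:ℝ)..t, k₁ t s • x s) v + b v (∫ s in (0:ℝ)..t, k₂ t s • y s) := by
    intro t x y v hx hy
    have e1 := ContinuousLinearMap.intervalIntegral_comp_comm (a.flip v) hx
    have e2 := ContinuousLinearMap.intervalIntegral_comp_comm (b v) hy
    have j1 : IntervalIntegrable (fun s => a.flip v (k₁ t s • x s)) volume 0 t :=
      ⟨(a.flip v).integrable_comp hx.1, (a.flip v).integrable_comp hx.2⟩
    have j2 : IntervalIntegrable (fun s => b v (k₂ t s • y s)) volume 0 t :=
      ⟨(b v).integrable_comp hy.1, (b v).integrable_comp hy.2⟩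
    rw [← e2, ← ContinuousLinearMap.flip_apply a, ← e1, ← intervalIntegral.integral_add j1 j2]
    simp
  set Su : ℝ → V := fun t => ∫ s in (0:ℝ)..t, k₁ t s • (u s - uI s) with hSu
  set Sp : ℝ → Q := fun t => ∫ s in (0:ℝ)..t, k₂ t s • (p s - pI s) with hSp
  set Nu := ∫ t in (0:ℝ)..T, ‖u t - uI t‖ with hNu
  set Np := ∫ t in (0:ℝ)..T, ‖p t - pI t‖ with hNp
  have hNu0 : 0 ≤ Nu := intervalIntegral.integral_nonneg hT.le fun _ _ => norm_nonneg _
  have hNp0 : 0 ≤ Np := intervalIntegral.integral_nonneg hT.le fun _ _ => norm_nonneg _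
  have clm : ∀ {E E' : Type _} [NormedAddCommGroup E] [NormedSpace ℝ E]
      [NormedAddCommGroup E'] [NormedSpace ℝ E'] (L : E →L[ℝ] E') (w : ℝ → E),
      IntervalIntegrable w volume 0 T → IntervalIntegrable (fun t => L (w t)) volume 0 T :=
    fun L w h => ⟨L.integrable_comp h.1, L.integrable_comp h.2⟩
  have clm2 : ∀ (L : Q →L[ℝ] Q →L[ℝ] ℝ) (w : ℝ → Q),
      IntervalIntegrable w volume 0 T → IntervalIntegrable (fun t => L (w t)) volume 0 T :=
    fun L w h => ⟨L.integrable_comp h.1, L.integrable_comp h.2⟩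
  have clm3 : ∀ (L : Q →L[ℝ] V →L[ℝ] ℝ) (w : ℝ → Q),
      IntervalIntegrable w volume 0 T → IntervalIntegrable (fun t => L (w t)) volume 0 T :=
    fun L w h => ⟨L.integrable_comp h.1, L.integrable_comp h.2⟩
  have clm4 : ∀ (L : V →L[ℝ] Q →L[ℝ] ℝ) (w : ℝ → V),
      IntervalIntegrable w volume 0 T → IntervalIntegrable (fun t => L (w t)) volume 0 T :=
    fun L w h => ⟨L.integrable_comp h.1, L.integrable_comp h.2⟩
  set F : ℝ → V →L[ℝ] ℝ := fun t =>
    a ((u t - uI t) - Su t) + b.flip ((p t - pI t) - Sp t) with hF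
  set G : ℝ → Q →L[ℝ] ℝ := fun t => b (u t - uI t) - lam • innerSL ℝ (p t - pI t) with hG
  have hFi : IntervalIntegrable F volume 0 T :=
    (clm a _ (hηu.sub m1)).add (clm3 b.flip _ (hηp.sub m2))
  have hGi : IntervalIntegrable G volume 0 T :=
    (clm4 b _ hηu).sub (clm2 (lam • innerSL ℝ) _ hηp)
  have hbn : ‖b.flip‖ = ‖b‖ := b.opNorm_flip
  have hFn : (∫ t in (0:ℝ)..T, ‖F t‖)
      ≤ ‖a‖ * (1 + T * max Ck1 Ck2) * Nu + ‖b‖ * (1 + T * max Ck1 Ck2) * Np := by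
    have hle : (∫ t in (0:ℝ)..T, ‖F t‖) ≤ ∫ t in (0:ℝ)..T,
        (‖a‖ * ‖u t - uI t‖ + ‖b‖ * ‖p t - pI t‖ +
          (‖a‖ * (max Ck1 Ck2 * Nu) + ‖b‖ * (max Ck1 Ck2 * Np))) := by
      refine intervalIntegral.integral_mono_ae_restrict hT.le hFi.norm
        (((hηu.norm.const_mul _).add (hηp.norm.const_mul _)).add intervalIntegrable_const) ?_
      filter_upwards [ae_restrict_of_ae b1, ae_restrict_of_ae b2,
        ae_restrict_mem measurableSet_Icc] with t h1 h2 ht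
      have h1 : ‖Su t‖ ≤ max Ck1 Ck2 * Nu :=
        (h1 ht).trans (mul_le_mul_of_nonneg_right (le_max_left _ _) hNu0)
      have h2 : ‖Sp t‖ ≤ max Ck1 Ck2 * Np :=
        (h2 ht).trans (mul_le_mul_of_nonneg_right (le_max_right _ _) hNp0)
      have h3 : ‖a ((u t - uI t) - Su t)‖ ≤ ‖a‖ * (‖u t - uI t‖ + max Ck1 Ck2 * Nu) :=
        (a.le_opNorm _).trans (mul_le_mul_of_nonneg_left
          ((norm_sub_le _ _).trans (by gcongr)) (norm_nonneg _))
      have h4 : ‖b.flip ((p t - pI t) - Sp t)‖ ≤ ‖b‖ * (‖p t - pI t‖ + max Ck1 Ck2 * Np) := by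
        rw [← hbn]
        exact (b.flip.le_opNorm _).trans (mul_le_mul_of_nonneg_left
          ((norm_sub_le _ _).trans (by gcongr)) (norm_nonneg _))
      have h5 : ‖F t‖ ≤ _ := norm_add_le _ _
      show ‖F t‖ ≤ _
      linarith
    refine hle.trans (le_of_eq ?_)
    rw [intervalIntegral.integral_add ((hηu.norm.const_mul _).add (hηp.norm.const_mul _))
      intervalIntegrable_const, intervalIntegral.integral_add (hηu.norm.const_mul _)
      (hηp.norm.const_mul _), intervalIntegral.integral_const_mul,
      intervalIntegral.integral_const_mul, intervalIntegral.integral_const, smul_eq_mul]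
    ring
  have hGn : (∫ t in (0:ℝ)..T, ‖G t‖) ≤ ‖b‖ * Nu + lam * Np := by
    have hle : (∫ t in (0:ℝ)..T, ‖G t‖) ≤ ∫ t in (0:ℝ)..T,
        (‖b‖ * ‖u t - uI t‖ + lam * ‖p t - pI t‖) := by
      refine intervalIntegral.integral_mono_on hT.le hGi.norm
        ((hηu.norm.const_mul _).add (hηp.norm.const_mul _)) ?_
      intro t ht
      have h5 : ‖G t‖ ≤ _ := norm_sub_le _ _
      rw [norm_smul, innerSL_apply_norm, Real.norm_eq_abs, abs_of_pos hlam] at h5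
      have := b.le_opNorm (u t - uI t)
      linarith
    refine hle.trans (le_of_eq ?_)
    rw [intervalIntegral.integral_add (hηu.norm.const_mul _)
      (hηp.norm.const_mul _), intervalIntegral.integral_const_mul,
      intervalIntegral.integral_const_mul]
  obtain ⟨s1, s2⟩ := hstab F G (fun t => uh t - uI t) (fun t => ph t - pI t) hFi hGi hξu hξp
    (fun t => Vh.sub_mem (huh_mem t) (huIm t)) (fun t => Qh.sub_mem (hph_mem t) (hpIm t)) (by
      filter_upwards [hsol, hsolh, i3, i4, i5, i6, i7, i8] with t e eh j3 j4 j5 j6 j7 j8 ht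
      obtain ⟨e1, e2⟩ := e ht
      obtain ⟨eh1, eh2⟩ := eh ht
      have j3 := j3 ht
      have j4 := j4 ht
      have j5 := j5 ht
      have j6 := j6 ht
      have j7 := j7 ht
      have j8 := j8 ht
      constructor
      · intro v hv
        have q1 := e1 v
        have q2 := eh1 v hv
        rw [split t _ _ v j3 j4] at q1
        rw [split t _ _ v j5 j6] at q2
        rw [split t (fun t => uh t - uI t) (fun t => ph t - pI t) v
          (by simpa only [smul_sub] using j5.sub j7) (by simpa only [smul_sub] using j6.sub j8)]
        have r1 : Su t = (∫ s in (0:ℝ)..t, k₁ t s • u s) - ∫ s in (0:ℝ)..t, k₁ t s • uI s := by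
          rw [← intervalIntegral.integral_sub j3 j7]; simp only [hSu, smul_sub]
        have r2 : Sp t = (∫ s in (0:ℝ)..t, k₂ t s • p s) - ∫ s in (0:ℝ)..t, k₂ t s • pI s := by
          rw [← intervalIntegral.integral_sub j4 j8]; simp only [hSp, smul_sub]
        have r3 : (∫ s in (0:ℝ)..t, k₁ t s • (uh s - uI s))
            = (∫ s in (0:ℝ)..t, k₁ t s • uh s) - ∫ s in (0:ℝ)..t, k₁ t s • uI s := by
          rw [← intervalIntegral.integral_sub j5 j7]; simp only [smul_sub]
        have r4 : (∫ s in (0:ℝ)..t, k₂ t s • (ph s - pI s))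
            = (∫ s in (0:ℝ)..t, k₂ t s • ph s) - ∫ s in (0:ℝ)..t, k₂ t s • pI s := by
          rw [← intervalIntegral.integral_sub j6 j8]; simp only [smul_sub]
        simp only [hF, r1, r2, r3, r4, map_sub, ContinuousLinearMap.add_apply,
          ContinuousLinearMap.sub_apply, ContinuousLinearMap.flip_apply]
        linarith
      · intro q hq
        have q1 := e2 q
        have q2 := eh2 q hq
        simp only [hG, map_sub, ContinuousLinearMap.sub_apply, ContinuousLinearMap.smul_apply,
          innerSL_apply_apply, smul_eq_mul, inner_sub_left]
        linarith)
  have t1 : (∫ t in (0:ℝ)..T, ‖uh t - u t‖) ≤ (∫ t in (0:ℝ)..T, ‖uh t - uI t‖) + Nu := by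
    rw [hNu, ← intervalIntegral.integral_add hξu.norm hηu.norm]
    refine intervalIntegral.integral_mono_on hT.le (huh.sub hu).norm (hξu.norm.add hηu.norm) ?_
    intro t _
    rw [norm_sub_rev (u t)]
    exact norm_sub_le_norm_sub_add_norm_sub _ _ _
  have t2 : (∫ t in (0:ℝ)..T, ‖ph t - p t‖) ≤ (∫ t in (0:ℝ)..T, ‖ph t - pI t‖) + Np := by
    rw [hNp, ← intervalIntegral.integral_add hξp.norm hηp.norm]
    refine intervalIntegral.integral_mono_on hT.le (hph.sub hp).norm (hξp.norm.add hηp.norm) ?_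
    intro t _
    rw [norm_sub_rev (p t)]
    exact norm_sub_le_norm_sub_add_norm_sub _ _ _
  have c1 := mul_le_mul_of_nonneg_left hFn hC₁.le
  have c2 := mul_le_mul_of_nonneg_left hGn hC₂.le
  have c3 := mul_le_mul_of_nonneg_left hFn hC₃.le
  have c4 := mul_le_mul_of_nonneg_left hGn hC₄.le
  constructor
  · linarith
  · linarith
end
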